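/- Let R be a left and right noetherian ring with an Ore set S of non-zero-divisors, satisfying Assumption (⋆), and let 𝓕: 𝓒 → Ω be a quasi-Fitting invariant. Then there is a unique family of maps { 𝓕^⟨n⟩: 𝓜 → Ω }_{n ∈ ℤ} satisfying: (a) 𝓕^⟨0⟩ extends 𝓕: 𝓒 → Ω; (b) 𝓕^⟨n⟩(P) ∈ Ω^× for every P ∈ 𝓠 and n ∈ ℤ; (c) for every exact sequence 0 → N → P → M → 0 in 𝓜 with P ∈ 𝓠, 𝓕^⟨n⟩(M) = 𝓕^⟨n⟩(P)·𝓕^⟨n-1⟩(N) for all n ∈ ℤ; (d) for every exact sequence 0 → M' → M → P → 0 in 𝓜 with P ∈ 𝓠, 𝓕^⟨n⟩(M) = 𝓕^⟨n⟩(P)·𝓕^⟨n⟩(M') for all n ∈ ℤ; (e) for every exact sequence 0 → P → M → M' → 0 in 𝓜 with P ∈ 𝓠, 𝓕^⟨n⟩(M) = 𝓕^⟨n⟩(P)·𝓕^⟨n⟩(M') for all n ∈ ℤ. -/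

import Mathlib

open CategoryTheory MulOpposite

noncomputable section

/-- `M` is `S`-torsion: every element is annihilated by some element of `S`. -/
def STorsion (R : Type) [Ring R] (S : Submonoid R) (M : Type) [AddCommGroup M] [Module R M] :
    Prop :=
  ∀ m : M, ∃ s ∈ S, s • m = 0

/-- Projective dimension `≤ n`, witnessed by resolutions with finite free stages. -/
def PdLE (R : Type) [Ring R] : ℕ → (M : Type) → [AddCommGroup M] → [Module R M] → Prop
  | 0, M, _, _ => Module.Projective R M
  | n+1, M, _, _ => ∃ (k : ℕ) (f : (Fin k → R) →ₗ[R] M),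
      Function.Surjective f ∧ PdLE R n (LinearMap.ker f)

/-- Finite projective dimension. -/
def FinitePd (R : Type) [Ring R] (M : Type) [AddCommGroup M] [Module R M] : Prop :=
  ∃ n, PdLE R n M

/-- Membership in the category `𝓜` of finitely generated `S`-torsion modules. -/
def MemM (R : Type) [Ring R] (S : Submonoid R) (M : Type) [AddCommGroup M] [Module R M] : Prop :=
  Module.Finite R M ∧ STorsion R S M

/-- Membership in `𝓟`: finitely generated `S`-torsion of projective dimension `≤ 1`. -/
def MemP (R : Type) [Ring R] (S : Submonoid R) (M : Type) [AddCommGroup M] [Module R M] : Prop :=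
  MemM R S M ∧ PdLE R 1 M

/-- Membership in `𝓠`: finitely generated `S`-torsion of finite projective dimension. -/
def MemQ (R : Type) [Ring R] (S : Submonoid R) (M : Type) [AddCommGroup M] [Module R M] : Prop :=
  MemM R S M ∧ FinitePd R M

/-- The Ext group `Ext^i_R(M, N)`. -/
abbrev extGroup (R : Type) [Ring R] (M N : Type) [AddCommGroup M] [Module R M]
    [AddCommGroup N] [Module R N] (i : ℕ) : Type :=
  (((_root_.Ext ℤ (ModuleCat R) i).obj (Opposite.op (ModuleCat.of R M))).obj (ModuleCat.of R N))

/-- Vanishing of `Ext^i_R(M, R)`. -/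
def ExtRVanish (R : Type) [Ring R] (M : Type) [AddCommGroup M] [Module R M] (i : ℕ) : Prop :=
  Subsingleton (extGroup R M R i)

/-- `pd*_R(M) ≤ 1`, i.e. `Ext^i_R(M, R) = 0` for all `i ≥ 2`. -/
def PdStarLE1 (R : Type) [Ring R] (M : Type) [AddCommGroup M] [Module R M] : Prop :=
  ∀ i, 2 ≤ i → ExtRVanish R M i

/-- Membership in `𝓒`: finitely generated `S`-torsion with `pd* ≤ 1`. -/
def MemC (R : Type) [Ring R] (S : Submonoid R) (M : Type) [AddCommGroup M] [Module R M] : Prop :=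
  MemM R S M ∧ PdStarLE1 R M

/-- Assumption (⋆): a uniform bound `d(R)` on `pd*` of all finitely generated left or
right `R`-modules. -/
def AssumptionStar (R : Type) [Ring R] : Prop :=
  ∃ d : ℕ,
    (∀ (M : Type) [AddCommGroup M] [Module R M], Module.Finite R M →
      ∀ i, d < i → ExtRVanish R M i) ∧
    (∀ (M : Type) [AddCommGroup M] [Module Rᵐᵒᵖ M], Module.Finite Rᵐᵒᵖ M →
      ∀ i, d < i → ExtRVanish Rᵐᵒᵖ M i)

/-- `S` is a (left and right) Ore set consisting of non-zero-divisors. -/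
def IsOreSet (R : Type) [Ring R] (S : Submonoid R) : Prop :=
  S ≤ nonZeroDivisors R ∧
    (∀ f ∈ S, ∀ a : R, ∃ r : R, ∃ s ∈ S, f * r = a * s) ∧
    (∀ f ∈ S, ∀ a : R, ∃ r : R, ∃ s ∈ S, r * f = s * a)

/-- A sequence of `R`-modules and maps, used to encode finite exact sequences. -/
structure ModSeq (R : Type) [Ring R] where
  C : ℕ → Type
  [acg : ∀ i, AddCommGroup (C i)]
  [mod : ∀ i, Module R (C i)]
  f : ∀ i, C i →ₗ[R] C (i+1)

attribute [instance] ModSeq.acg ModSeq.mod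

/-- `D.ExactTrunc n` : the window `0 → C 0 → C 1 → ⋯ → C (n+1) → 0` is exact. -/
def ModSeq.ExactTrunc {R : Type} [Ring R] (D : ModSeq R) (n : ℕ) : Prop :=
  Function.Injective (D.f 0) ∧ Function.Surjective (D.f n) ∧
    ∀ i < n, Function.Exact (D.f i) (D.f (i+1))

/-- The (initial) Fitting ideal of a module over a commutative ring. -/
def fittingIdeal (R : Type) [CommRing R] (M : Type) [AddCommGroup M] [Module R M] : Ideal R :=
  Ideal.span { x : R | ∃ (a : ℕ) (A : Matrix (Fin a) (Fin a) R) (π : (Fin a → R) →ₗ[R] M),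
    Function.Surjective π ∧ (∀ j, π (fun i => A i j) = 0) ∧ x = A.det }

/-- The Fitting ideal viewed as a fractional ideal, i.e. a finitely generated
`R`-submodule of `S⁻¹R`. -/
def fittFrac (R : Type) [CommRing R] (S : Submonoid R) (M : Type) [AddCommGroup M]
    [Module R M] : Submodule R (Localization S) :=
  Submodule.map (Algebra.linearMap R (Localization S)) (fittingIdeal R M)

/-- Precomposition with `ι`, as a map of right `R`-modules `Hom(F, R) → Hom(N, R)`. -/
def precompDual (R : Type) [Ring R] {N F : Type} [AddCommGroup N] [Module R N]
    [AddCommGroup F] [Module R F] (ι : N →ₗ[R] F) :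
    (F →ₗ[R] R) →ₗ[Rᵐᵒᵖ] (N →ₗ[R] R) where
  toFun g := g.comp ι
  map_add' _ _ := LinearMap.ext fun _ => rfl
  map_smul' _ _ := LinearMap.ext fun _ => rfl

/-- `Ext^1_R(M, R)` computed from a presentation `0 → N → F → M → 0` with `F` projective:
the cokernel of `Hom(F, R) → Hom(N, R)`; it is a right `R`-module. -/
abbrev ExtOneDual (R : Type) [Ring R] {N F : Type} [AddCommGroup N] [Module R N]
    [AddCommGroup F] [Module R F] (ι : N →ₗ[R] F) : Type :=
  (N →ₗ[R] R) ⧸ LinearMap.range (precompDual R ι)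

/-- Precomposition with `ι`, commutative case. -/
def precompDualComm (R : Type) [CommRing R] {N F : Type} [AddCommGroup N] [Module R N]
    [AddCommGroup F] [Module R F] (ι : N →ₗ[R] F) :
    (F →ₗ[R] R) →ₗ[R] (N →ₗ[R] R) where
  toFun g := g.comp ι
  map_add' _ _ := LinearMap.ext fun _ => rfl
  map_smul' _ _ := LinearMap.ext fun _ => rfl

/-- `Ext^1_R(M, R)` computed from a presentation, commutative case. -/
abbrev ExtOneDualComm (R : Type) [CommRing R] {N F : Type} [AddCommGroup N] [Module R N]
    [AddCommGroup F] [Module R F] (ι : N →ₗ[R] F) : Type :=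
  (N →ₗ[R] R) ⧸ LinearMap.range (precompDualComm R ι)

/-- A Fitting invariant `𝓕 : 𝓜 → Ω`. -/
def IsFittingInv (R : Type) [Ring R] (S : Submonoid R) {Ω : Type} [CommMonoid Ω]
    (F : (M : Type) → [AddCommGroup M] → [Module R M] → Ω) : Prop :=
  (∀ (P : Type) [AddCommGroup P] [Module R P], MemP R S P → IsUnit (F P)) ∧
  (∀ (M' M P : Type) [AddCommGroup M'] [Module R M'] [AddCommGroup M] [Module R M]
      [AddCommGroup P] [Module R P], MemM R S M' → MemM R S M → MemP R S P →
    ∀ (ι : M' →ₗ[R] M) (p : M →ₗ[R] P), Function.Injective ι → Function.Surjective p →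
      Function.Exact ι p → F M = F P * F M')

/-- A quasi-Fitting invariant `𝓕 : 𝓒 → Ω`. -/
def IsQuasiFittingInv (R : Type) [Ring R] (S : Submonoid R) {Ω : Type} [CommMonoid Ω]
    (F : (M : Type) → [AddCommGroup M] → [Module R M] → Ω) : Prop :=
  (∀ (P : Type) [AddCommGroup P] [Module R P], MemP R S P → IsUnit (F P)) ∧
  (∀ (M' M P : Type) [AddCommGroup M'] [Module R M'] [AddCommGroup M] [Module R M]
      [AddCommGroup P] [Module R P], MemC R S M' → MemC R S M → MemP R S P →
    ∀ (ι : M' →ₗ[R] M) (p : M →ₗ[R] P), Function.Injective ι → Function.Surjective p →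
      Function.Exact ι p → F M = F P * F M') ∧
  (∀ (P M M' : Type) [AddCommGroup P] [Module R P] [AddCommGroup M] [Module R M]
      [AddCommGroup M'] [Module R M'], MemP R S P → MemC R S M → MemC R S M' →
    ∀ (ι : P →ₗ[R] M) (p : M →ₗ[R] M'), Function.Injective ι → Function.Surjective p →
      Function.Exact ι p → F M = F P * F M')

/-- The membership predicate of `𝓜` as a family. -/
def MemMFam (R : Type) [Ring R] (S : Submonoid R) (M : Type) [AddCommGroup M] [Module R M] :
    Prop :=
  MemM R S M

/-- The membership predicate of `𝓒` as a family. -/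
def MemCFam (R : Type) [Ring R] (S : Submonoid R) (M : Type) [AddCommGroup M] [Module R M] :
    Prop :=
  MemC R S M

/-- `ω` is the value obtained from an exact sequence `0 → N → P₁ → ⋯ → Pₙ → M → 0`
(`n ≥ 0`), with all terms satisfying `Mem`, each `Pᵢ ∈ 𝓟`, via the formula
`ω = (∏ i, 𝓕(Pᵢ)^((-1)^i)) · 𝓕(N)`; inverses are recorded by witnesses `u`. -/
def PosShiftValue (R : Type) [Ring R] (S : Submonoid R) {Ω : Type} [CommMonoid Ω]
    (Mem : (M : Type) → [AddCommGroup M] → [Module R M] → Prop)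
    (F : (M : Type) → [AddCommGroup M] → [Module R M] → Ω) (n : ℕ)
    (M : Type) [AddCommGroup M] [Module R M] (ω : Ω) : Prop :=
  ∃ D : ModSeq R, D.ExactTrunc n ∧ Nonempty (D.C (n+1) ≃ₗ[R] M) ∧
    (∀ i, i ≤ n+1 → Mem (D.C i)) ∧ (∀ i, 1 ≤ i → i ≤ n → MemP R S (D.C i)) ∧
    ∃ u : ℕ → Ω, (∀ i, 1 ≤ i → i ≤ n → F (D.C i) * u i = 1) ∧
      ω = (∏ i ∈ Finset.range n, if (i+1) % 2 = 1 then u (i+1) else F (D.C (i+1))) * F (D.C 0)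

/-- `ω` is the value obtained from an exact sequence `0 → M → P_m → ⋯ → P₁ → N → 0`
(`m ≥ 1` corresponding to the shift `n = -m < 0`) via the formula
`ω = (∏ i, 𝓕(Pᵢ)^((-1)^i)) · 𝓕(N)`. -/
def NegShiftValue (R : Type) [Ring R] (S : Submonoid R) {Ω : Type} [CommMonoid Ω]
    (Mem : (M : Type) → [AddCommGroup M] → [Module R M] → Prop)
    (F : (M : Type) → [AddCommGroup M] → [Module R M] → Ω) (m : ℕ)
    (M : Type) [AddCommGroup M] [Module R M] (ω : Ω) : Prop :=
  ∃ D : ModSeq R, D.ExactTrunc m ∧ Nonempty (D.C 0 ≃ₗ[R] M) ∧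
    (∀ i, i ≤ m+1 → Mem (D.C i)) ∧ (∀ i, 1 ≤ i → i ≤ m → MemP R S (D.C i)) ∧
    ∃ u : ℕ → Ω, (∀ i, 1 ≤ i → i ≤ m → F (D.C i) * u i = 1) ∧
      ω = (∏ i ∈ Finset.range m, if (i+1) % 2 = 1 then u (m-i) else F (D.C (m-i))) * F (D.C (m+1))

/-- `ω` is the value of the `n`-th shift (`n ∈ ℤ`) of `F` at `M` computed from some
admissible exact sequence whose terms satisfy `Mem`. -/
def ShiftValue (R : Type) [Ring R] (S : Submonoid R) {Ω : Type} [CommMonoid Ω]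
    (Mem : (M : Type) → [AddCommGroup M] → [Module R M] → Prop)
    (F : (M : Type) → [AddCommGroup M] → [Module R M] → Ω) (n : ℤ)
    (M : Type) [AddCommGroup M] [Module R M] (ω : Ω) : Prop :=
  if 0 ≤ n then PosShiftValue R S Mem F n.toNat M ω else NegShiftValue R S Mem F (-n).toNat M ω

/-- The axioms for the family of shifts `{𝓕⁽ⁿ⁾ : 𝓜 → Ω}` of a quasi-Fitting invariant. -/
def IsShiftFamily (R : Type) [Ring R] (S : Submonoid R) {Ω : Type} [CommMonoid Ω]
    (F : (M : Type) → [AddCommGroup M] → [Module R M] → Ω)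
    (G : ℤ → (M : Type) → [AddCommGroup M] → [Module R M] → Ω) : Prop :=
  (∀ (M : Type) [AddCommGroup M] [Module R M], MemC R S M → G 0 M = F M) ∧
  (∀ (n : ℤ) (P : Type) [AddCommGroup P] [Module R P], MemQ R S P → IsUnit (G n P)) ∧
  (∀ (n : ℤ) (N P M : Type) [AddCommGroup N] [Module R N] [AddCommGroup P] [Module R P]
      [AddCommGroup M] [Module R M], MemM R S N → MemQ R S P → MemM R S M →
    ∀ (ι : N →ₗ[R] P) (p : P →ₗ[R] M), Function.Injective ι → Function.Surjective p →
      Function.Exact ι p → G n M = G n P * G (n-1) N) ∧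
  (∀ (n : ℤ) (M' M P : Type) [AddCommGroup M'] [Module R M'] [AddCommGroup M] [Module R M]
      [AddCommGroup P] [Module R P], MemM R S M' → MemM R S M → MemQ R S P →
    ∀ (ι : M' →ₗ[R] M) (p : M →ₗ[R] P), Function.Injective ι → Function.Surjective p →
      Function.Exact ι p → G n M = G n P * G n M') ∧
  (∀ (n : ℤ) (P M M' : Type) [AddCommGroup P] [Module R P] [AddCommGroup M] [Module R M]
      [AddCommGroup M'] [Module R M'], MemQ R S P → MemM R S M → MemM R S M' →
    ∀ (ι : P →ₗ[R] M) (p : M →ₗ[R] M'), Function.Injective ι → Function.Surjective p →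
      Function.Exact ι p → G n M = G n P * G n M')

end

/-- `0 → A → B → C → 0` is a short exact sequence of modules. -/
structure IsSES {R : Type} [Ring R] {A B C : Type} [AddCommGroup A] [Module R A]
    [AddCommGroup B] [Module R B] [AddCommGroup C] [Module R C]
    (f : A →ₗ[R] B) (g : B →ₗ[R] C) : Prop where
  inj : Function.Injective f
  surj : Function.Surjective g
  exact : Function.Exact f g

section ExtVanishing

variable {R : Type} [Ring R]

theorem extRVanish_succ_iff (M : Type) [AddCommGroup M] [Module R M] (n : ℕ) :
    ExtRVanish R M (n + 1) ↔
      Subsingleton (Abelian.Ext (ModuleCat.of R M) (ModuleCat.of R R) (n + 1)) := by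
  let P := ProjectiveResolution.of (ModuleCat.of R M)
  let Y := ModuleCat.of R R
  have key : Subsingleton (Abelian.Ext (ModuleCat.of R M) Y (n + 1)) ↔
      ∀ f : P.complex.X (n + 1) ⟶ Y, P.complex.d (n + 2) (n + 1) ≫ f = 0 →
        ∃ g : P.complex.X n ⟶ Y, P.complex.d (n + 1) n ≫ g = f := by
    constructor
    · intro h f hf
      exact (P.extMk_eq_zero_iff f (n + 2) rfl hf n rfl).1 (Subsingleton.elim _ _)
    · intro h
      refine subsingleton_of_forall_eq 0 fun α => ?_
      obtain ⟨f, hf, rfl⟩ := P.extMk_surjective α (n + 2) rfl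
      exact (P.extMk_eq_zero_iff f (n + 2) rfl hf n rfl).2 (h f hf)
  rw [key]
  have e := P.isoExt (R := ℤ) (n + 1) Y
  have h1 : ExtRVanish R M (n + 1) ↔
      (P.complex.linearYonedaObj ℤ Y).ExactAt (n + 1) := by
    rw [HomologicalComplex.exactAt_iff_isZero_homology, ← e.isZero_iff,
      ModuleCat.isZero_iff_subsingleton]
    rfl
  rw [h1, HomologicalComplex.exactAt_iff' _ n (n + 1) (n + 2) (by simp) (by simp),
    ShortComplex.moduleCat_exact_iff]
  rfl

section LongExactSequence

variable {A B C : Type} [AddCommGroup A] [Module R A] [AddCommGroup B] [Module R B]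
  [AddCommGroup C] [Module R C] {f : A →ₗ[R] B} {g : B →ₗ[R] C}

theorem IsSES.comp_eq_zero (h : IsSES f g) : g.comp f = 0 :=
  LinearMap.ext fun x => h.exact.apply_apply_eq_zero x

/-- The short complex in `ModuleCat R` attached to a short exact sequence. -/
abbrev IsSES.toShortComplex (h : IsSES f g) : ShortComplex (ModuleCat.{0} R) :=
  ShortComplex.mk (ModuleCat.ofHom f) (ModuleCat.ofHom g)
    (by rw [← ModuleCat.ofHom_comp, h.comp_eq_zero]; rfl)

theorem IsSES.shortExact (h : IsSES f g) : h.toShortComplex.ShortExact :=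
  ModuleCat.shortComplex_shortExact _ h.exact h.inj h.surj

theorem IsSES.extRVanish_mid (h : IsSES f g) {n : ℕ} (hA : ExtRVanish R A (n + 1))
    (hC : ExtRVanish R C (n + 1)) : ExtRVanish R B (n + 1) := by
  rw [extRVanish_succ_iff] at *
  refine subsingleton_of_forall_eq 0 fun x => ?_
  obtain ⟨y, rfl⟩ := Abelian.Ext.contravariant_sequence_exact₂ h.shortExact
    (ModuleCat.of R R) x (Subsingleton.elim _ _)
  rw [Subsingleton.elim y 0, Abelian.Ext.comp_zero]

theorem IsSES.extRVanish_right (h : IsSES f g) {n : ℕ} (hA : ExtRVanish R A (n + 1))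
    (hB : ExtRVanish R B (n + 2)) : ExtRVanish R C (n + 2) := by
  rw [extRVanish_succ_iff] at *
  refine subsingleton_of_forall_eq 0 fun x => ?_
  obtain ⟨y, rfl⟩ := Abelian.Ext.contravariant_sequence_exact₃ h.shortExact
    (ModuleCat.of R R) x (Subsingleton.elim _ _) (add_comm 1 (n + 1))
  rw [Subsingleton.elim y 0, Abelian.Ext.comp_zero]

theorem IsSES.extRVanish_left (h : IsSES f g) {n : ℕ} (hB : ExtRVanish R B (n + 1))
    (hC : ExtRVanish R C (n + 2)) : ExtRVanish R A (n + 1) := by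
  rw [extRVanish_succ_iff] at *
  refine subsingleton_of_forall_eq 0 fun x => ?_
  obtain ⟨y, rfl⟩ := Abelian.Ext.contravariant_sequence_exact₁ h.shortExact
    (ModuleCat.of R R) x (add_comm 1 (n + 1)) (Subsingleton.elim _ _)
  rw [Subsingleton.elim y 0, Abelian.Ext.comp_zero]

theorem IsSES.exists_extension (h : IsSES f g) (hC : ExtRVanish R C 1) (φ : A →ₗ[R] R) :
    ∃ ψ : B →ₗ[R] R, ψ.comp f = φ := by
  rw [extRVanish_succ_iff] at hC
  obtain ⟨y, hy⟩ := Abelian.Ext.contravariant_sequence_exact₁ h.shortExact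
    (ModuleCat.of R R) (Abelian.Ext.mk₀ (ModuleCat.ofHom φ)) (add_comm 1 0)
    (Subsingleton.elim _ _)
  obtain ⟨ψ, rfl⟩ := (Abelian.Ext.mk₀_bijective _ _).2 y
  refine ⟨ψ.hom, ?_⟩
  rw [Abelian.Ext.mk₀_comp_mk₀] at hy
  have := (Abelian.Ext.mk₀_bijective _ _).1 hy
  exact congrArg ModuleCat.Hom.hom this

theorem extRVanish_of_projective (P : Type) [AddCommGroup P] [Module R P]
    [Module.Projective R P] (n : ℕ) : ExtRVanish R P (n + 1) := by
  have : Projective (ModuleCat.of R P) := (IsProjective.iff_projective P).1 inferInstance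
  rw [extRVanish_succ_iff]
  exact subsingleton_of_forall_eq 0 fun x => Abelian.Ext.eq_zero_of_projective x

theorem IsSES.extRVanish_one (h : IsSES f g) [Module.Projective R B]
    (hext : ∀ φ : A →ₗ[R] R, ∃ ψ : B →ₗ[R] R, ψ.comp f = φ) : ExtRVanish R C 1 := by
  have hB := extRVanish_of_projective (R := R) B 0
  rw [extRVanish_succ_iff] at *
  refine subsingleton_of_forall_eq 0 fun x => ?_
  obtain ⟨y, rfl⟩ := Abelian.Ext.contravariant_sequence_exact₃ h.shortExact
    (ModuleCat.of R R) x (Subsingleton.elim _ _) (add_comm 1 0)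
  obtain ⟨φ, rfl⟩ := (Abelian.Ext.mk₀_bijective _ _).2 y
  obtain ⟨ψ, hψ⟩ := hext φ.hom
  have : φ = h.toShortComplex.f ≫ ModuleCat.ofHom ψ := by
    ext x
    exact (LinearMap.congr_fun hψ x).symm
  rw [this, ← Abelian.Ext.mk₀_comp_mk₀, ShortComplex.ShortExact.extClass_comp_assoc]

end LongExactSequence

section FiniteProjectiveDimension

theorem isSES_ker {M N : Type} [AddCommGroup M] [Module R M] [AddCommGroup N] [Module R N]
    {g : M →ₗ[R] N} (hg : Function.Surjective g) : IsSES (LinearMap.ker g).subtype g :=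
  ⟨Subtype.val_injective, hg, g.exact_subtype_ker_map⟩

theorem PdLE.hasProjectiveDimensionLE {n : ℕ} {M : Type} [AddCommGroup M] [Module R M]
    (h : PdLE R n M) : HasProjectiveDimensionLE (ModuleCat.of R M) n := by
  induction n generalizing M with
  | zero =>
    rw [← projective_iff_hasProjectiveDimensionLE_zero, ← IsProjective.iff_projective]
    exact h
  | succ n ih =>
    obtain ⟨k, f, hf, hk⟩ := h
    exact (isSES_ker hf).shortExact.hasProjectiveDimensionLT_X₃ (n + 1) (ih hk)
      (have : Projective (ModuleCat.of R (Fin k → R)) :=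
        (IsProjective.iff_projective _).1 inferInstance
       inferInstanceAs (HasProjectiveDimensionLT (ModuleCat.of R (Fin k → R)) (n + 1 + 1)))

theorem pdLE_of_hasProjectiveDimensionLE [IsNoetherianRing R] {n : ℕ} {M : Type}
    [AddCommGroup M] [Module R M] [Module.Finite R M]
    (h : HasProjectiveDimensionLE (ModuleCat.of R M) n) : PdLE R n M := by
  induction n generalizing M with
  | zero =>
    rw [← projective_iff_hasProjectiveDimensionLE_zero, ← IsProjective.iff_projective] at h
    exact h
  | succ n ih =>
    obtain ⟨k, f, hf⟩ := Module.Finite.exists_fin' R M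
    have : Projective (ModuleCat.of R (Fin k → R)) :=
      (IsProjective.iff_projective _).1 inferInstance
    exact ⟨k, f, hf, ih (((isSES_ker hf).shortExact.hasProjectiveDimensionLT_X₃_iff n this).1 h)⟩

theorem finitePd_iff [IsNoetherianRing R] {M : Type} [AddCommGroup M] [Module R M]
    [Module.Finite R M] :
    FinitePd R M ↔ ∃ n, ∀ m, n ≤ m → HasProjectiveDimensionLT (ModuleCat.of R M) m := by
  constructor
  · rintro ⟨n, h⟩
    have := h.hasProjectiveDimensionLE
    exact ⟨n + 1, fun m hm => hasProjectiveDimensionLT_of_ge _ _ m hm⟩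
  · rintro ⟨n, h⟩
    exact ⟨n, pdLE_of_hasProjectiveDimensionLE (h (n + 1) n.le_succ)⟩

variable {A B C : Type} [AddCommGroup A] [Module R A] [AddCommGroup B] [Module R B]
  [AddCommGroup C] [Module R C] {f : A →ₗ[R] B} {g : B →ₗ[R] C}

theorem IsSES.finitePd_mid [IsNoetherianRing R] [Module.Finite R A] [Module.Finite R B]
    [Module.Finite R C] (h : IsSES f g) (hA : FinitePd R A) (hC : FinitePd R C) :
    FinitePd R B := by
  rw [finitePd_iff] at *
  obtain ⟨a, ha⟩ := hA
  obtain ⟨c, hc⟩ := hC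
  exact ⟨max a c, fun m hm => h.shortExact.hasProjectiveDimensionLT_X₂ m
    (ha m (by omega)) (hc m (by omega))⟩

theorem IsSES.finitePd_right [IsNoetherianRing R] [Module.Finite R A] [Module.Finite R B]
    [Module.Finite R C] (h : IsSES f g) (hA : FinitePd R A) (hB : FinitePd R B) :
    FinitePd R C := by
  rw [finitePd_iff] at *
  obtain ⟨a, ha⟩ := hA
  obtain ⟨b, hb⟩ := hB
  refine ⟨max a b + 1, fun m hm => ?_⟩
  obtain ⟨m, rfl⟩ : ∃ k, m = k + 1 := ⟨m - 1, by omega⟩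
  exact h.shortExact.hasProjectiveDimensionLT_X₃ m (ha m (by omega)) (hb (m + 1) (by omega))

theorem IsSES.finitePd_left [IsNoetherianRing R] [Module.Finite R A] [Module.Finite R B]
    [Module.Finite R C] (h : IsSES f g) (hB : FinitePd R B) (hC : FinitePd R C) :
    FinitePd R A := by
  rw [finitePd_iff] at *
  obtain ⟨b, hb⟩ := hB
  obtain ⟨c, hc⟩ := hC
  exact ⟨max b c, fun m hm => h.shortExact.hasProjectiveDimensionLT_X₁ m
    (hb m (by omega)) (hc (m + 1) (by omega))⟩

/-- A finitely generated module of finite projective dimension with no higher extensions by the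
ring is projective. -/
theorem PdLE.projective [IsNoetherianRing R] {n : ℕ} {M : Type} [AddCommGroup M] [Module R M]
    [Module.Finite R M] (h : PdLE R n M) (hE : ∀ i, ExtRVanish R M (i + 1)) :
    Module.Projective R M := by
  induction n generalizing M with
  | zero => exact h
  | succ n ih =>
    obtain ⟨k, p, hp, hk⟩ := h
    have hs := isSES_ker hp
    have hK : Module.Projective R (LinearMap.ker p) := ih hk fun i =>
      hs.extRVanish_left (extRVanish_of_projective _ _) (hE (i + 1))
    obtain ⟨j, q, hq⟩ := Module.Finite.exists_fin' R (LinearMap.ker p)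
    obtain ⟨s, hs'⟩ := Module.projective_lifting_property q LinearMap.id hq
    choose ψ hψ using fun i : Fin j => hs.exists_extension (hE 0) ((LinearMap.proj i).comp s)
    let r : (Fin k → R) →ₗ[R] LinearMap.ker p := q.comp (LinearMap.pi ψ)
    have hr : r.comp (LinearMap.ker p).subtype = LinearMap.id := by
      rw [← hs', LinearMap.comp_assoc]
      congr 1
      ext x i
      exact LinearMap.congr_fun (hψ i) x
    have ht := hs.exact.split_tfae'.out 1 0
    obtain ⟨-, σ, hσ⟩ := ht.1 ⟨hp, r, hr⟩
    exact Module.Projective.of_split σ p hσ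

theorem pdLE_one_of_finitePd [IsNoetherianRing R] {M : Type} [AddCommGroup M] [Module R M]
    [Module.Finite R M] (h : FinitePd R M) (hE : PdStarLE1 R M) : PdLE R 1 M := by
  obtain ⟨k, p, hp⟩ := Module.Finite.exists_fin' R M
  have hs := isSES_ker hp
  obtain ⟨n, hn⟩ := hs.finitePd_left ⟨0, show Module.Projective R _ from inferInstance⟩ h
  exact ⟨k, p, hp, hn.projective fun i =>
    hs.extRVanish_left (extRVanish_of_projective _ _) (hE (i + 2) (by omega))⟩

end FiniteProjectiveDimension

end ExtVanishing

section Torsion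

variable {R : Type} [Ring R] {S : Submonoid R}

/-- The torsion elements of a module over a ring with a left Ore set form a submodule. -/
def oreTorsion (hS : IsOreSet R S) (M : Type) [AddCommGroup M] [Module R M] : Submodule R M where
  carrier := {m | ∃ s ∈ S, s • m = 0}
  zero_mem' := ⟨1, S.one_mem, smul_zero _⟩
  add_mem' := by
    rintro a b ⟨s, hs, ha⟩ ⟨t, ht, hb⟩
    obtain ⟨r, u, hu, h⟩ := hS.2.2 s hs t
    refine ⟨u * t, S.mul_mem hu ht, ?_⟩
    rw [smul_add, mul_smul u t b, hb, ← h, mul_smul, ha, smul_zero, smul_zero, add_zero]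
  smul_mem' := by
    rintro c m ⟨s, hs, hm⟩
    obtain ⟨r, u, hu, h⟩ := hS.2.2 s hs c
    exact ⟨u, hu, by rw [smul_smul, ← h, mul_smul, hm, smul_zero]⟩

theorem STorsion.of_span (hS : IsOreSet R S) {M : Type} [AddCommGroup M] [Module R M]
    {ι : Type*} {v : ι → M} (hv : ⊤ ≤ Submodule.span R (Set.range v))
    (h : ∀ i, ∃ s ∈ S, s • v i = 0) : STorsion R S M := by
  intro m
  have : Submodule.span R (Set.range v) ≤ oreTorsion hS M :=
    Submodule.span_le.2 (by rintro _ ⟨i, rfl⟩; exact h i)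
  exact this (hv trivial)

theorem IsOreSet.left_cancel (hS : IsOreSet R S) {s : R} (hs : s ∈ S) {x : R} (h : s * x = 0) :
    x = 0 :=
  (mem_nonZeroDivisors_iff.1 (hS.1 hs)).1 x h

theorem IsOreSet.right_cancel (hS : IsOreSet R S) {s : R} (hs : s ∈ S) {x : R} (h : x * s = 0) :
    x = 0 :=
  (mem_nonZeroDivisors_iff.1 (hS.1 hs)).2 x h

variable {A B C : Type} [AddCommGroup A] [Module R A] [AddCommGroup B] [Module R B]
  [AddCommGroup C] [Module R C] {f : A →ₗ[R] B} {g : B →ₗ[R] C}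

theorem MemM.of_injective [IsNoetherianRing R] (hB : MemM R S B) (hf : Function.Injective f) :
    MemM R S A := by
  have := hB.1
  refine ⟨Module.Finite.of_injective f hf, fun a => ?_⟩
  obtain ⟨s, hs, h⟩ := hB.2 (f a)
  exact ⟨s, hs, hf (by rw [map_smul, h, map_zero])⟩

theorem MemM.of_surjective (hB : MemM R S B) (hg : Function.Surjective g) : MemM R S C := by
  have := hB.1
  refine ⟨Module.Finite.of_surjective g hg, fun c => ?_⟩
  obtain ⟨b, rfl⟩ := hg c
  obtain ⟨s, hs, h⟩ := hB.2 b
  exact ⟨s, hs, by rw [← map_smul, h, map_zero]⟩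

theorem IsSES.memM_mid (h : IsSES f g) (hA : MemM R S A) (hC : MemM R S C) : MemM R S B := by
  have := hA.1
  have := hC.1
  refine ⟨⟨Submodule.fg_of_fg_map_of_fg_inf_ker g ?_ ?_⟩, fun b => ?_⟩
  · rw [Submodule.map_top, LinearMap.range_eq_top.2 h.surj]
    exact Module.Finite.fg_top
  · rw [top_inf_eq, h.exact.linearMap_ker_eq, LinearMap.range_eq_map]
    exact Module.Finite.fg_top.map f
  · obtain ⟨s, hs, hb⟩ := hC.2 (g b)
    rw [← map_smul] at hb
    obtain ⟨a, ha⟩ := (h.exact _).1 hb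
    obtain ⟨t, ht, h'⟩ := hA.2 a
    exact ⟨t * s, S.mul_mem ht hs, by rw [mul_smul, ← ha, ← map_smul, h', map_zero]⟩

theorem memM_of_subsingleton (M : Type) [AddCommGroup M] [Module R M] [Subsingleton M] :
    MemM R S M :=
  ⟨inferInstance, fun _ => ⟨1, S.one_mem, Subsingleton.elim _ _⟩⟩

end Torsion

section DiagonalQuotient

variable {R : Type} [Ring R] {S : Submonoid R}

/-- Right multiplication by `s i` on the `i`-th coordinate. -/
def diagMap {n : ℕ} (s : Fin n → R) : (Fin n → R) →ₗ[R] (Fin n → R) :=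
  LinearMap.pi fun i => (LinearMap.toSpanSingleton R R (s i)).comp (LinearMap.proj i)

@[simp]
theorem diagMap_apply {n : ℕ} (s : Fin n → R) (x : Fin n → R) (i : Fin n) :
    diagMap s x i = x i * s i := rfl

theorem diagMap_single {n : ℕ} (s : Fin n → R) (i : Fin n) :
    diagMap s (Pi.single i 1) = s i • Pi.single i 1 := by
  ext j
  rcases eq_or_ne j i with rfl | h
  · simp
  · simp [h]

theorem diagMap_injective (hS : IsOreSet R S) {n : ℕ} {s : Fin n → R} (hs : ∀ i, s i ∈ S) :
    Function.Injective (diagMap s) := by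
  rw [← LinearMap.ker_eq_bot, LinearMap.ker_eq_bot']
  intro x hx
  ext i
  exact hS.right_cancel (hs i) (congrFun hx i)

/-- The direct sum of the modules `R ⧸ R s i`. -/
abbrev DiagQuot {n : ℕ} (s : Fin n → R) : Type := (Fin n → R) ⧸ LinearMap.range (diagMap s)

theorem memP_diagQuot (hS : IsOreSet R S) {n : ℕ} {s : Fin n → R} (hs : ∀ i, s i ∈ S) :
    MemP R S (DiagQuot s) := by
  refine ⟨⟨inferInstance, ?_⟩, n, (LinearMap.range (diagMap s)).mkQ,
    Submodule.mkQ_surjective _, ?_⟩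
  · refine STorsion.of_span hS (v := fun i : Fin n =>
      (LinearMap.range (diagMap s)).mkQ (Pi.single i 1)) ?_ fun i => ⟨s i, hs i, ?_⟩
    · have h : Set.range (fun i : Fin n => (LinearMap.range (diagMap s)).mkQ (Pi.single i 1)) =
          (LinearMap.range (diagMap s)).mkQ '' Set.range (Pi.basisFun R (Fin n)) := by
        rw [← Set.range_comp]
        congr 1
        ext i
        simp
      rw [h, Submodule.span_image, (Pi.basisFun R (Fin n)).span_eq, Submodule.map_top,
        Submodule.range_mkQ]
    · rw [← map_smul, ← diagMap_single]
      exact (Submodule.Quotient.mk_eq_zero _).2 ⟨_, rfl⟩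
  · change Module.Projective R _
    rw [Submodule.ker_mkQ]
    exact Module.Projective.of_equiv (LinearEquiv.ofInjective _ (diagMap_injective hS hs))

theorem exists_lift_of_surjective {A B C : Type} [AddCommGroup A] [Module R A] [AddCommGroup B]
    [Module R B] [AddCommGroup C] [Module R C] {g : A →ₗ[R] B} (hg : Function.Surjective g)
    (q : A →ₗ[R] C) (h : ∀ a, g a = 0 → q a = 0) : ∃ j : B →ₗ[R] C, ∀ a, j (g a) = q a := by
  refine ⟨((LinearMap.ker g).liftQ q h).comp (g.quotKerEquivOfSurjective hg).symm.toLinearMap,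
    fun a => ?_⟩
  have : (g.quotKerEquivOfSurjective hg).symm (g a) = (LinearMap.ker g).mkQ a := by
    rw [LinearEquiv.symm_apply_eq]
    rfl
  change (LinearMap.ker g).liftQ q h ((g.quotKerEquivOfSurjective hg).symm (g a)) = q a
  rw [this]
  rfl

/-- Every finitely generated torsion module is a quotient of a module in `𝓟`. -/
theorem MemM.exists_cover (hS : IsOreSet R S) {M : Type} [AddCommGroup M] [Module R M]
    (hM : MemM R S M) : ∃ (P : Type) (_ : AddCommGroup P) (_ : Module R P) (p : P →ₗ[R] M),
      MemP R S P ∧ Function.Surjective p := by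
  have := hM.1
  obtain ⟨n, g, hg⟩ := Module.Finite.exists_fin' R M
  choose s hs hsg using fun i : Fin n => hM.2 (g (Pi.single i 1))
  have h0 : g.comp (diagMap s) = 0 := by
    ext i
    simp [diagMap_single, hsg]
  refine ⟨DiagQuot s, inferInstance, inferInstance,
    (LinearMap.range (diagMap s)).liftQ g (by
      rintro _ ⟨x, rfl⟩
      exact LinearMap.congr_fun h0 x), memP_diagQuot hS hs, fun m => ?_⟩
  obtain ⟨x, rfl⟩ := hg m
  exact ⟨Submodule.Quotient.mk x, rfl⟩

end DiagonalQuotient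

section Dual

variable {R : Type} [Ring R]

/-- A ring is isomorphic, as a right module over itself, to its opposite. -/
def opEquivSelf (R : Type) [Ring R] : R ≃ₗ[Rᵐᵒᵖ] Rᵐᵒᵖ where
  toFun := op
  invFun := unop
  map_add' _ _ := rfl
  map_smul' _ _ := rfl
  left_inv _ := rfl
  right_inv _ := rfl

theorem finite_dual_fin (R : Type) [Ring R] (k : ℕ) :
    Module.Finite Rᵐᵒᵖ ((Fin k → R) →ₗ[R] R) := by
  have : Module.Finite Rᵐᵒᵖ R := Module.Finite.equiv (opEquivSelf R).symm
  exact Module.Finite.equiv ((Pi.basisFun R (Fin k)).constr Rᵐᵒᵖ)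

theorem projective_dual_fin (R : Type) [Ring R] (k : ℕ) :
    Module.Projective Rᵐᵒᵖ ((Fin k → R) →ₗ[R] R) := by
  have : Module.Free Rᵐᵒᵖ R := Module.Free.of_equiv (opEquivSelf R).symm
  exact Module.Projective.of_equiv ((Pi.basisFun R (Fin k)).constr Rᵐᵒᵖ : (Fin k → R) ≃ₗ[Rᵐᵒᵖ] _)

variable {A B C : Type} [AddCommGroup A] [Module R A] [AddCommGroup B] [Module R B]
  [AddCommGroup C] [Module R C] {f : A →ₗ[R] B} {g : B →ₗ[R] C}

theorem precompDual_injective (hg : Function.Surjective g) :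
    Function.Injective (precompDual R g) := fun _ _ h =>
  LinearMap.cancel_right hg |>.1 h

theorem finite_dual [IsNoetherianRing Rᵐᵒᵖ] (N : Type) [AddCommGroup N] [Module R N]
    [Module.Finite R N] : Module.Finite Rᵐᵒᵖ (N →ₗ[R] R) := by
  obtain ⟨k, p, hp⟩ := Module.Finite.exists_fin' R N
  have := finite_dual_fin R k
  exact Module.Finite.of_injective (precompDual R p) (precompDual_injective hp)

theorem IsSES.dual (h : IsSES f g) (hC : ExtRVanish R C 1) :
    IsSES (precompDual R g) (precompDual R f) where
  inj := precompDual_injective h.surj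
  surj := h.exists_extension hC
  exact := by
    intro φ
    constructor
    · intro hφ
      obtain ⟨j, hj⟩ := exists_lift_of_surjective h.surj φ fun b hb => by
        obtain ⟨a, rfl⟩ := (h.exact b).1 hb
        exact LinearMap.congr_fun hφ a
      exact ⟨j, LinearMap.ext hj⟩
    · rintro ⟨ψ, rfl⟩
      ext a
      change ψ (g (f a)) = 0
      rw [h.exact.apply_apply_eq_zero, map_zero]

theorem extRVanish_dual [IsNoetherianRing R] [IsNoetherianRing Rᵐᵒᵖ] (hstar : AssumptionStar R)
    {N : Type} [AddCommGroup N] [Module R N] [Module.Finite R N]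
    (hN : ∀ i, ExtRVanish R N (i + 1)) (i : ℕ) : ExtRVanish Rᵐᵒᵖ (N →ₗ[R] R) (i + 1) := by
  obtain ⟨d, -, hd⟩ := hstar
  obtain ⟨m, hm⟩ : ∃ m, d ≤ i + m := ⟨d, by omega⟩
  induction m generalizing i N with
  | zero => exact hd _ (finite_dual N) _ (by omega)
  | succ m ih =>
    obtain ⟨k, p, hp⟩ := Module.Finite.exists_fin' R N
    have hs := isSES_ker hp
    have := projective_dual_fin R k
    exact (hs.dual (hN 0)).extRVanish_left (extRVanish_of_projective _ _)
      (ih (fun j => hs.extRVanish_left (extRVanish_of_projective _ _) (hN (j + 1))) (i + 1)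
        (by omega))

theorem exists_eval_eq [IsNoetherianRing R] [IsNoetherianRing Rᵐᵒᵖ] (hstar : AssumptionStar R)
    {N : Type} [AddCommGroup N] [Module R N] [Module.Finite R N]
    (hN : ∀ i, ExtRVanish R N (i + 1)) (e : (N →ₗ[R] R) →ₗ[Rᵐᵒᵖ] R) :
    ∃ n : N, ∀ φ : N →ₗ[R] R, e φ = φ n := by
  obtain ⟨k, p, hp⟩ := Module.Finite.exists_fin' R N
  have hs := isSES_ker hp
  have hK : ∀ i, ExtRVanish R (LinearMap.ker p) (i + 1) := fun i =>
    hs.extRVanish_left (extRVanish_of_projective _ _) (hN (i + 1))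
  obtain ⟨e', he'⟩ := (hs.dual (hN 0)).exists_extension (extRVanish_dual hstar hK 0)
    ((opEquivSelf R).toLinearMap.comp e)
  refine ⟨p fun i => unop (e' (LinearMap.proj i)), fun φ => ?_⟩
  have h1 : e φ = unop (e' (φ.comp p)) := by
    have := LinearMap.congr_fun he' φ
    exact congrArg unop this.symm
  have h2 : φ.comp p = ∑ i, op (φ (p (Pi.single i 1))) •
      (LinearMap.proj i : (Fin k → R) →ₗ[R] R) := by
    ext j
    simp [Pi.single_apply, Finset.sum_apply]
  rw [h1, h2, map_sum]
  conv_rhs => rw [pi_eq_sum_univ' (fun i => unop (e' (LinearMap.proj i)))]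
  simp [map_sum]

end Dual

section Embedding

variable {R : Type} [Ring R] {S : Submonoid R}

theorem MemP.memC {M : Type} [AddCommGroup M] [Module R M] (h : MemP R S M) : MemC R S M := by
  refine ⟨h.1, fun i hi => ?_⟩
  obtain ⟨k, p, hp, hk⟩ := h.2
  have : Module.Projective R (LinearMap.ker p) := hk
  obtain ⟨i, rfl⟩ := Nat.exists_eq_add_of_le' hi
  exact (isSES_ker hp).extRVanish_right (extRVanish_of_projective _ _)
    (extRVanish_of_projective _ _)

theorem eq_zero_of_comp_eq_zero (hS : IsOreSet R S) {X Y : Type} [AddCommGroup X] [Module R X]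
    [AddCommGroup Y] [Module R Y] {δ : Y →ₗ[R] X} (h : ∀ x, ∃ u ∈ S, ∃ y, δ y = u • x)
    {φ : X →ₗ[R] R} (hφ : φ.comp δ = 0) : φ = 0 := by
  ext x
  obtain ⟨u, hu, y, hy⟩ := h x
  have := LinearMap.congr_fun hφ y
  refine hS.left_cancel hu ?_
  rw [← smul_eq_mul, ← map_smul, ← hy]
  exact this

theorem IsOreSet.exists_common_denominator (hS : IsOreSet R S) {ι : Type*} (J : Finset ι)
    {t : ι → R} (ht : ∀ i, t i ∈ S) (c : ι → R) :
    ∃ s ∈ S, ∀ i ∈ J, ∃ b, t i * b = c i * s := by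
  classical
  induction J using Finset.induction_on with
  | empty => exact ⟨1, S.one_mem, by simp⟩
  | insert j J hj ih =>
    obtain ⟨s, hs, h⟩ := ih
    obtain ⟨r, s', hs', h'⟩ := hS.2.1 (t j) (ht j) (c j * s)
    refine ⟨s * s', S.mul_mem hs hs', fun i hi => ?_⟩
    rcases Finset.mem_insert.1 hi with rfl | hi
    · exact ⟨r, by rw [h', mul_assoc]⟩
    · obtain ⟨b, hb⟩ := h i hi
      exact ⟨b * s', by rw [← mul_assoc, hb, mul_assoc]⟩

/-- A functional on the kernel of a presentation of a torsion module extends to the free module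
after right multiplication by an element of `S`. -/
theorem exists_extension_mul (hS : IsOreSet R S) {M : Type} [AddCommGroup M] [Module R M]
    (hM : STorsion R S M) {k : ℕ} (g : (Fin k → R) →ₗ[R] M) (φ : LinearMap.ker g →ₗ[R] R) :
    ∃ s ∈ S, ∃ ψ : (Fin k → R) →ₗ[R] R, ∀ x : LinearMap.ker g, ψ x = φ x * s := by
  choose t ht htg using fun i : Fin k => hM (g (Pi.single i 1))
  have h0 : g.comp (diagMap t) = 0 := by
    ext i
    simp [diagMap_single, htg]
  let δ : (Fin k → R) →ₗ[R] LinearMap.ker g :=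
    (diagMap t).codRestrict _ fun y => LinearMap.congr_fun h0 y
  obtain ⟨s, hs, h⟩ := hS.exists_common_denominator Finset.univ ht
    fun i => φ (δ (Pi.single i 1))
  choose b hb using fun i => h i (Finset.mem_univ i)
  let ψ : (Fin k → R) →ₗ[R] R := (Pi.basisFun R (Fin k)).constr ℕ b
  refine ⟨s, hs, ψ, fun x => ?_⟩
  have hD : ψ.comp (LinearMap.ker g).subtype - (LinearMap.toSpanSingleton R R s).comp φ = 0 := by
    refine eq_zero_of_comp_eq_zero hS (δ := δ) (fun x => ?_) ?_
    · obtain ⟨u, hu, hx⟩ := (memP_diagQuot hS ht).1.2 (Submodule.Quotient.mk (x : Fin k → R))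
      rw [← Submodule.Quotient.mk_smul, Submodule.Quotient.mk_eq_zero] at hx
      obtain ⟨y, hy⟩ := hx
      exact ⟨u, hu, y, Subtype.ext hy⟩
    · refine (Pi.basisFun R (Fin k)).ext fun i => ?_
      have h1 : ((δ (Pi.single i 1) : LinearMap.ker g) : Fin k → R) = t i • Pi.single i 1 :=
        diagMap_single t i
      have h2 : ψ (Pi.single i 1) = b i := by
        have := (Pi.basisFun R (Fin k)).constr_basis ℕ b i
        rwa [Pi.basisFun_apply] at this
      rw [Pi.basisFun_apply]
      simp only [LinearMap.comp_apply, LinearMap.sub_apply, Submodule.subtype_apply, h1, map_smul,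
        h2, LinearMap.toSpanSingleton_apply, LinearMap.zero_apply, smul_eq_mul, hb, sub_self]
  have := LinearMap.congr_fun hD x
  exact sub_eq_zero.1 this

/-- Evaluation at a point, as a map of right modules. -/
def evalDual {X : Type} [AddCommGroup X] [Module R X] (x : X) : (X →ₗ[R] R) →ₗ[Rᵐᵒᵖ] R where
  toFun φ := φ x
  map_add' _ _ := rfl
  map_smul' _ _ := rfl

theorem MemC.exists_embedding [IsNoetherianRing R] [IsNoetherianRing Rᵐᵒᵖ] (hS : IsOreSet R S)
    (hstar : AssumptionStar R) {M : Type} [AddCommGroup M] [Module R M] (hM : MemC R S M) :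
    ∃ (P C : Type) (_ : AddCommGroup P) (_ : Module R P) (_ : AddCommGroup C) (_ : Module R C)
      (j : M →ₗ[R] P) (q : P →ₗ[R] C), MemP R S P ∧ MemC R S C ∧ IsSES j q := by
  have := hM.1.1
  obtain ⟨k, g, hg⟩ := Module.Finite.exists_fin' R M
  have hN : ∀ i, ExtRVanish R (LinearMap.ker g) (i + 1) := fun i =>
    (isSES_ker hg).extRVanish_left (extRVanish_of_projective _ _) (hM.2 (i + 2) (by omega))
  have := finite_dual (R := R) (LinearMap.ker g)
  obtain ⟨n, φ, hφ⟩ := Module.Finite.exists_fin (R := Rᵐᵒᵖ) (M := LinearMap.ker g →ₗ[R] R)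
  choose s hs ψ hψ using fun i => exists_extension_mul hS hM.1.2 g (φ i)
  let Ψ : (Fin k → R) →ₗ[R] (Fin n → R) := LinearMap.pi ψ
  let Φ : LinearMap.ker g →ₗ[R] (Fin n → R) := LinearMap.pi φ
  have hΨ : ∀ x : LinearMap.ker g, Ψ x = diagMap s (Φ x) := fun x => funext fun i => hψ i x
  have hdi := diagMap_injective hS hs
  let Q := LinearMap.range (diagMap s)
  obtain ⟨j, hj⟩ := exists_lift_of_surjective hg (Q.mkQ.comp Ψ) fun x hx => by
    refine (Submodule.Quotient.mk_eq_zero _).2 ?_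
    rw [hΨ ⟨x, hx⟩]
    exact ⟨_, rfl⟩
  have hker : ∀ x, Ψ x ∈ Q → g x = 0 := by
    intro x hx
    let X := Q.comap Ψ
    let ι : LinearMap.ker g →ₗ[R] X := (LinearMap.ker g).subtype.codRestrict X fun y => by
      change Ψ y ∈ Q
      rw [hΨ y]
      exact ⟨_, rfl⟩
    let Φ' : X →ₗ[R] (Fin n → R) := (LinearEquiv.ofInjective _ hdi).symm.toLinearMap.comp
      ((Ψ.comp X.subtype).codRestrict Q fun y => y.2)
    have hΦ' : ∀ y : X, diagMap s (Φ' y) = Ψ y := fun y =>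
      congrArg Subtype.val ((LinearEquiv.ofInjective _ hdi).apply_symm_apply
        ((Ψ.comp X.subtype).codRestrict Q (fun y => y.2) y))
    have hbij : Function.Bijective (precompDual R ι) := by
      constructor
      · rw [injective_iff_map_eq_zero]
        refine fun χ hχ => eq_zero_of_comp_eq_zero hS (δ := ι) (fun y => ?_) hχ
        obtain ⟨u, hu, h⟩ := hM.1.2 (g y)
        rw [← map_smul] at h
        exact ⟨u, hu, ⟨_, h⟩, Subtype.ext rfl⟩
      · rw [← LinearMap.range_eq_top, ← top_le_iff, ← hφ, Submodule.span_le]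
        rintro _ ⟨i, rfl⟩
        refine ⟨(LinearMap.proj i).comp Φ', LinearMap.ext fun y => ?_⟩
        have h1 : Φ' (ι y) = Φ y := hdi (by rw [hΦ', ← hΨ]; rfl)
        exact congrFun h1 i
    obtain ⟨y, hy⟩ := exists_eval_eq hstar hN ((evalDual (⟨x, hx⟩ : X)).comp
      (LinearEquiv.ofBijective _ hbij).symm.toLinearMap)
    have h2 : ∀ χ : X →ₗ[R] R, χ ⟨x, hx⟩ = χ (ι y) := fun χ => by
      have := hy (precompDual R ι χ)
      have h3 : (LinearEquiv.ofBijective _ hbij).symm (precompDual R ι χ) = χ :=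
        (LinearEquiv.ofBijective _ hbij).symm_apply_apply χ
      simp only [LinearMap.comp_apply, LinearEquiv.coe_coe, h3] at this
      exact this
    have h3 : x = y := funext fun i => h2 ((LinearMap.proj i).comp X.subtype)
    rw [h3]
    exact y.2
  have hP := memP_diagQuot hS hs
  have hjinj : Function.Injective j := by
    rw [injective_iff_map_eq_zero]
    intro m hm
    obtain ⟨x, rfl⟩ := hg m
    rw [hj] at hm
    exact hker x ((Submodule.Quotient.mk_eq_zero _).1 hm)
  have hses : IsSES j (LinearMap.range j).mkQ :=
    ⟨hjinj, Submodule.mkQ_surjective _, LinearMap.exact_map_mkQ_range j⟩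
  refine ⟨DiagQuot s, DiagQuot s ⧸ LinearMap.range j, inferInstance, inferInstance, inferInstance,
    inferInstance, j, (LinearMap.range j).mkQ, hP, ⟨hP.1.of_surjective hses.surj, ?_⟩, hses⟩
  intro i hi
  obtain ⟨i, rfl⟩ := Nat.exists_eq_add_of_le' hi
  rcases i with _ | i
  swap
  · exact hses.extRVanish_right (hM.2 _ (by omega)) (hP.memC.2 _ (by omega))
  let π := (LinearMap.range j).mkQ.comp Q.mkQ
  have hπ : Function.Surjective π :=
    (Submodule.mkQ_surjective _).comp (Submodule.mkQ_surjective _)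
  refine (isSES_ker hπ).extRVanish_right ?_ (extRVanish_of_projective _ _)
  let ρ : ((Fin k → R) × (Fin n → R)) →ₗ[R] LinearMap.ker π :=
    (Ψ.coprod (diagMap s)).codRestrict _ (by
      rintro ⟨x, y⟩
      refine (Submodule.Quotient.mk_eq_zero _).2 ⟨g x, ?_⟩
      rw [hj]
      refine (Submodule.Quotient.eq Q).2 ⟨-y, ?_⟩
      simp)
  have hρ : IsSES ((LinearMap.ker g).subtype.prod (-Φ)) ρ := by
    refine ⟨fun x y h => Subtype.ext (congrArg Prod.fst h), ?_, ?_⟩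
    · rintro ⟨v, hv⟩
      obtain ⟨m, hm⟩ := (Submodule.Quotient.mk_eq_zero _).1 hv
      obtain ⟨x, rfl⟩ := hg m
      rw [hj] at hm
      obtain ⟨y, hy⟩ := (Submodule.Quotient.eq Q).1 hm.symm
      exact ⟨(x, y), Subtype.ext (by
        change Ψ x + diagMap s y = v
        rw [hy]
        abel)⟩
    · rintro ⟨x, y⟩
      have hxy : ρ (x, y) = 0 ↔ Ψ x + diagMap s y = 0 := Subtype.ext_iff
      rw [hxy]
      constructor
      · intro h
        have hx : g x = 0 := hker x ⟨-y, by rw [map_neg]; exact (eq_neg_of_add_eq_zero_left h).symm⟩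
        refine ⟨⟨x, hx⟩, Prod.ext rfl (hdi ?_)⟩
        change diagMap s (-Φ ⟨x, hx⟩) = diagMap s y
        rw [map_neg, ← hΨ]
        exact (eq_neg_of_add_eq_zero_right h).symm
      · rintro ⟨z, hz⟩
        obtain ⟨rfl, rfl⟩ := Prod.ext_iff.1 hz
        change Ψ z + diagMap s (-Φ z) = 0
        rw [map_neg, hΨ, add_neg_cancel]
  refine hρ.extRVanish_one fun χ => ?_
  have hχ : χ ∈ Submodule.span Rᵐᵒᵖ (Set.range φ) := hφ ▸ Submodule.mem_top
  obtain ⟨c, rfl⟩ := (Submodule.mem_span_range_iff_exists_fun _).1 hχ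
  refine ⟨(-(∑ i, c i • LinearMap.proj i)).comp (LinearMap.snd R _ _), ?_⟩
  ext x
  simp [Φ]

end Embedding

section Filtration

variable {R : Type} [Ring R] {S : Submonoid R}

/-- Finitely generated `S`-torsion modules with `Ext^i(M, R) = 0` for `i ≥ k + 2`. -/
def MemD (R : Type) [Ring R] (S : Submonoid R) (k : ℕ) (M : Type) [AddCommGroup M] [Module R M] :
    Prop :=
  MemM R S M ∧ ∀ i, ExtRVanish R M (i + k + 2)

theorem memD_zero_iff {M : Type} [AddCommGroup M] [Module R M] : MemD R S 0 M ↔ MemC R S M := by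
  refine and_congr_right fun _ => ⟨fun h i hi => ?_, fun h i => h _ (by omega)⟩
  obtain ⟨i, rfl⟩ := Nat.exists_eq_add_of_le' hi
  exact h i

theorem MemD.mono {M : Type} [AddCommGroup M] [Module R M] {k l : ℕ} (h : MemD R S k M)
    (hkl : k ≤ l) : MemD R S l M := by
  refine ⟨h.1, fun i => ?_⟩
  have := h.2 (i + (l - k))
  rwa [show i + (l - k) + k + 2 = i + l + 2 by omega] at this

theorem AssumptionStar.exists_memD (hstar : AssumptionStar R) (S : Submonoid R) :
    ∃ d, ∀ (M : Type) [AddCommGroup M] [Module R M], MemM R S M → MemD R S d M := by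
  obtain ⟨d, hd, -⟩ := hstar
  exact ⟨d, fun M _ _ hM => ⟨hM, fun i => hd M hM.1 _ (by omega)⟩⟩

theorem MemP.memD {P : Type} [AddCommGroup P] [Module R P] (h : MemP R S P) (k : ℕ) :
    MemD R S k P := (memD_zero_iff.2 h.memC).mono (Nat.zero_le k)

theorem MemP.finitePd {P : Type} [AddCommGroup P] [Module R P] (h : MemP R S P) : FinitePd R P :=
  ⟨1, h.2⟩

theorem finitePd_of_subsingleton (M : Type) [AddCommGroup M] [Module R M] [Subsingleton M] :
    FinitePd R M :=
  ⟨0, show Module.Projective R M from inferInstance⟩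

theorem memD_of_subsingleton (k : ℕ) (M : Type) [AddCommGroup M] [Module R M] [Subsingleton M] :
    MemD R S k M :=
  ⟨memM_of_subsingleton M, fun i => extRVanish_of_projective M (i + k + 1)⟩

variable {A B C : Type} [AddCommGroup A] [Module R A] [AddCommGroup B] [Module R B]
  [AddCommGroup C] [Module R C] {f : A →ₗ[R] B} {g : B →ₗ[R] C} {k : ℕ}

theorem IsSES.memD_mid (h : IsSES f g) (hA : MemD R S k A) (hC : MemD R S k C) :
    MemD R S k B :=
  ⟨h.memM_mid hA.1 hC.1, fun i => h.extRVanish_mid (hA.2 i) (hC.2 i)⟩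

theorem IsSES.memD_left [IsNoetherianRing R] (h : IsSES f g) (hB : MemD R S k B)
    (hC : MemD R S (k + 1) C) : MemD R S k A :=
  ⟨hB.1.of_injective h.inj, fun i => h.extRVanish_left (hB.2 i) (hC.2 i)⟩

theorem isSES_id_left (M : Type) [AddCommGroup M] [Module R M] :
    IsSES (0 : PUnit.{1} →ₗ[R] M) (LinearMap.id : M →ₗ[R] M) :=
  ⟨Function.injective_of_subsingleton _, Function.surjective_id, fun _ =>
    ⟨fun h => ⟨0, h.symm⟩, fun ⟨_, h⟩ => h.symm⟩⟩

theorem isSES_id_right (M : Type) [AddCommGroup M] [Module R M] :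
    IsSES (LinearMap.id : M →ₗ[R] M) (0 : M →ₗ[R] PUnit.{1}) :=
  ⟨Function.injective_id, fun _ => ⟨0, rfl⟩, fun x => ⟨fun _ => ⟨x, rfl⟩, fun _ => rfl⟩⟩

theorem isSES_inl_snd (M N : Type) [AddCommGroup M] [Module R M] [AddCommGroup N] [Module R N] :
    IsSES (LinearMap.inl R M N) (LinearMap.snd R M N) :=
  ⟨LinearMap.inl_injective, LinearMap.snd_surjective, Function.Exact.inl_snd⟩

/-- The quotients of a module by the two steps of a filtration. -/
theorem IsSES.exists_quotient (h : IsSES f g) {T K : Type} [AddCommGroup T] [Module R T]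
    [AddCommGroup K] [Module R K] {e : B →ₗ[R] T} {q : T →ₗ[R] K} (h' : IsSES e q) :
    ∃ (Q : Type) (_ : AddCommGroup Q) (_ : Module R Q) (p : T →ₗ[R] Q) (u : C →ₗ[R] Q)
      (v : Q →ₗ[R] K), IsSES (e.comp f) p ∧ IsSES u v := by
  let p := (LinearMap.range (e.comp f)).mkQ
  have hp : IsSES (e.comp f) p :=
    ⟨h'.inj.comp h.inj, Submodule.mkQ_surjective _, LinearMap.exact_map_mkQ_range _⟩
  obtain ⟨u, hu⟩ := exists_lift_of_surjective h.surj (p.comp e) fun b hb => by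
    obtain ⟨a, rfl⟩ := (h.exact b).1 hb
    exact hp.exact.apply_apply_eq_zero a
  obtain ⟨v, hv⟩ := exists_lift_of_surjective hp.surj q fun t ht => by
    obtain ⟨a, rfl⟩ := (hp.exact t).1 ht
    exact h'.exact.apply_apply_eq_zero (f a)
  refine ⟨_, inferInstance, inferInstance, p, u, v, hp, ?_, ?_, ?_⟩
  · rw [injective_iff_map_eq_zero]
    intro c hc
    obtain ⟨b, rfl⟩ := h.surj c
    rw [hu] at hc
    obtain ⟨a, ha⟩ := (hp.exact _).1 hc
    rw [← h'.inj ha]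
    exact h.exact.apply_apply_eq_zero a
  · intro y
    obtain ⟨t, rfl⟩ := h'.surj y
    exact ⟨p t, hv t⟩
  · intro x
    obtain ⟨t, rfl⟩ := hp.surj x
    rw [hv, h'.exact]
    constructor
    · rintro ⟨b, rfl⟩
      exact ⟨g b, hu b⟩
    · rintro ⟨c, hc⟩
      obtain ⟨b, rfl⟩ := h.surj c
      rw [hu, ← sub_eq_zero] at hc
      change p (e b) - p t = 0 at hc
      rw [← map_sub] at hc
      obtain ⟨a, ha⟩ := (hp.exact _).1 hc
      refine ⟨b - f a, ?_⟩
      rw [map_sub]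
      change _ - (e.comp f) a = t
      rw [ha]
      abel

/-- The kernel of a composite of two surjections. -/
theorem IsSES.exists_kernel (h : IsSES f g) {T N : Type} [AddCommGroup T] [Module R T]
    [AddCommGroup N] [Module R N] {ι : N →ₗ[R] T} {r : T →ₗ[R] B} (h' : IsSES ι r) :
    ∃ (K : Type) (_ : AddCommGroup K) (_ : Module R K) (j : K →ₗ[R] T) (u : N →ₗ[R] K)
      (v : K →ₗ[R] A), IsSES j (g.comp r) ∧ IsSES u v := by
  have hj := isSES_ker (g := g.comp r) (h.surj.comp h'.surj)
  let u : N →ₗ[R] LinearMap.ker (g.comp r) := ι.codRestrict _ fun n => by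
    change g (r (ι n)) = 0
    rw [h'.exact.apply_apply_eq_zero, map_zero]
  let v : LinearMap.ker (g.comp r) →ₗ[R] A :=
    (LinearEquiv.ofInjective f h.inj).symm.toLinearMap.comp
      ((r.comp (LinearMap.ker (g.comp r)).subtype).codRestrict _ fun x => (h.exact _).1 x.2)
  have hv : ∀ x, f (v x) = r x := fun x =>
    congrArg Subtype.val ((LinearEquiv.ofInjective f h.inj).apply_symm_apply
      ((r.comp (LinearMap.ker (g.comp r)).subtype).codRestrict _ (fun x => (h.exact _).1 x.2) x))
  refine ⟨_, inferInstance, inferInstance, _, u, v, hj, fun x y hxy => ?_, fun a => ?_, fun x => ?_⟩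
  · exact h'.inj (congrArg Subtype.val hxy)
  · obtain ⟨t, ht⟩ := h'.surj (f a)
    refine ⟨⟨t, ?_⟩, h.inj ?_⟩
    · change g (r t) = 0
      rw [ht, h.exact.apply_apply_eq_zero]
    · rw [hv, ht]
  · rw [← map_eq_zero_iff f h.inj, hv, h'.exact]
    exact ⟨fun ⟨n, hn⟩ => ⟨n, Subtype.ext hn⟩, fun ⟨n, hn⟩ => ⟨n, congrArg Subtype.val hn⟩⟩

/-- Pullback of two surjections onto the same module. -/
theorem IsSES.exists_pullback {M N₁ P₁ N₂ P₂ : Type} [AddCommGroup M] [Module R M]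
    [AddCommGroup N₁] [Module R N₁] [AddCommGroup P₁] [Module R P₁]
    [AddCommGroup N₂] [Module R N₂] [AddCommGroup P₂] [Module R P₂]
    {i₁ : N₁ →ₗ[R] P₁} {p₁ : P₁ →ₗ[R] M} {i₂ : N₂ →ₗ[R] P₂} {p₂ : P₂ →ₗ[R] M}
    (h₁ : IsSES i₁ p₁) (h₂ : IsSES i₂ p₂) :
    ∃ (X : Type) (_ : AddCommGroup X) (_ : Module R X) (a₁ : N₁ →ₗ[R] X) (b₂ : X →ₗ[R] P₂)
      (a₂ : N₂ →ₗ[R] X) (b₁ : X →ₗ[R] P₁), IsSES a₁ b₂ ∧ IsSES a₂ b₁ := by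
  let X := LinearMap.eqLocus (p₁.comp (LinearMap.fst R P₁ P₂)) (p₂.comp (LinearMap.snd R P₁ P₂))
  have hX : ∀ x : X, p₁ x.1.1 = p₂ x.1.2 := fun x => x.2
  refine ⟨X, inferInstance, inferInstance,
    ((LinearMap.inl R P₁ P₂).comp i₁).codRestrict X fun n => ?_,
    (LinearMap.snd R P₁ P₂).comp X.subtype,
    ((LinearMap.inr R P₁ P₂).comp i₂).codRestrict X fun n => ?_,
    (LinearMap.fst R P₁ P₂).comp X.subtype, ⟨fun x y h => ?_, fun y => ?_, fun x => ?_⟩,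
    ⟨fun x y h => ?_, fun y => ?_, fun x => ?_⟩⟩
  · change p₁ (i₁ n) = p₂ 0
    rw [h₁.exact.apply_apply_eq_zero, map_zero]
  · change p₁ 0 = p₂ (i₂ n)
    rw [h₂.exact.apply_apply_eq_zero, map_zero]
  · exact h₁.inj (congrArg (fun z : X => z.1.1) h)
  · obtain ⟨x, hx⟩ := h₁.surj (p₂ y)
    exact ⟨⟨(x, y), hx⟩, rfl⟩
  · constructor
    · intro h
      change x.1.2 = 0 at h
      obtain ⟨n, hn⟩ := (h₁.exact x.1.1).1 (by rw [hX, h, map_zero])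
      exact ⟨n, Subtype.ext (Prod.ext hn h.symm)⟩
    · rintro ⟨n, rfl⟩
      rfl
  · exact h₂.inj (congrArg (fun z : X => z.1.2) h)
  · obtain ⟨x, hx⟩ := h₂.surj (p₁ y)
    exact ⟨⟨(y, x), hx.symm⟩, rfl⟩
  · constructor
    · intro h
      change x.1.1 = 0 at h
      obtain ⟨n, hn⟩ := (h₂.exact x.1.2).1 (by rw [← hX, h, map_zero])
      exact ⟨n, Subtype.ext (Prod.ext h.symm hn)⟩
    · rintro ⟨n, rfl⟩
      rfl

/-- Pushout of two injections out of the same module. -/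
theorem IsSES.exists_pushout {N P₁ C₁ P₂ C₂ : Type} [AddCommGroup N] [Module R N]
    [AddCommGroup P₁] [Module R P₁] [AddCommGroup C₁] [Module R C₁]
    [AddCommGroup P₂] [Module R P₂] [AddCommGroup C₂] [Module R C₂]
    {i₁ : N →ₗ[R] P₁} {p₁ : P₁ →ₗ[R] C₁} {i₂ : N →ₗ[R] P₂} {p₂ : P₂ →ₗ[R] C₂}
    (h₁ : IsSES i₁ p₁) (h₂ : IsSES i₂ p₂) :
    ∃ (Y : Type) (_ : AddCommGroup Y) (_ : Module R Y) (a₁ : P₁ →ₗ[R] Y) (b₂ : Y →ₗ[R] C₂)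
      (a₂ : P₂ →ₗ[R] Y) (b₁ : Y →ₗ[R] C₁), IsSES a₁ b₂ ∧ IsSES a₂ b₁ := by
  let Q := LinearMap.range (i₁.prod i₂)
  have hQ : ∀ x y, (Q.mkQ (x, y) = 0 ↔ ∃ n, i₁ n = x ∧ i₂ n = y) := fun x y => by
    rw [Submodule.mkQ_apply, Submodule.Quotient.mk_eq_zero]
    exact exists_congr fun n => Prod.ext_iff
  let b₂ := Q.liftQ (p₂.comp (LinearMap.snd R P₁ P₂)) (by
    rintro _ ⟨n, rfl⟩
    exact h₂.exact.apply_apply_eq_zero n)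
  let b₁ := Q.liftQ (p₁.comp (LinearMap.fst R P₁ P₂)) (by
    rintro _ ⟨n, rfl⟩
    exact h₁.exact.apply_apply_eq_zero n)
  have hb₁ : ∀ x y, b₁ (Q.mkQ (x, y)) = p₁ x := fun _ _ => rfl
  have hb₂ : ∀ x y, b₂ (Q.mkQ (x, y)) = p₂ y := fun _ _ => rfl
  refine ⟨(P₁ × P₂) ⧸ Q, inferInstance, inferInstance, Q.mkQ.comp (LinearMap.inl R P₁ P₂), b₂,
    Q.mkQ.comp (LinearMap.inr R P₁ P₂), b₁, ⟨?_, fun y => ?_, fun x => ?_⟩,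
    ⟨?_, fun y => ?_, fun x => ?_⟩⟩
  · rw [injective_iff_map_eq_zero]
    intro x hx
    obtain ⟨n, rfl, hn⟩ := (hQ x 0).1 hx
    rw [h₂.inj (hn.trans (map_zero _).symm), map_zero]
  · obtain ⟨y, rfl⟩ := h₂.surj y
    exact ⟨Q.mkQ (0, y), rfl⟩
  · obtain ⟨⟨x, y⟩, rfl⟩ := Q.mkQ_surjective x
    rw [hb₂, h₂.exact]
    constructor
    · rintro ⟨n, rfl⟩
      refine ⟨x - i₁ n, ?_⟩
      change Q.mkQ (x - i₁ n, 0) = _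
      rw [← sub_eq_zero, ← map_sub]
      exact (hQ _ _).2 ⟨-n, by simp, by simp⟩
    · rintro ⟨z, hz⟩
      change Q.mkQ (z, 0) = _ at hz
      rw [eq_comm, ← sub_eq_zero, ← map_sub] at hz
      obtain ⟨n, -, hn⟩ := (hQ _ _).1 hz
      exact ⟨n, by rw [hn]; exact sub_zero y⟩
  · rw [injective_iff_map_eq_zero]
    intro x hx
    obtain ⟨n, hn, rfl⟩ := (hQ 0 x).1 hx
    rw [h₁.inj (hn.trans (map_zero _).symm), map_zero]
  · obtain ⟨y, rfl⟩ := h₁.surj y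
    exact ⟨Q.mkQ (y, 0), rfl⟩
  · obtain ⟨⟨x, y⟩, rfl⟩ := Q.mkQ_surjective x
    rw [hb₁, h₁.exact]
    constructor
    · rintro ⟨n, rfl⟩
      refine ⟨y - i₂ n, ?_⟩
      change Q.mkQ (0, y - i₂ n) = _
      rw [← sub_eq_zero, ← map_sub]
      exact (hQ _ _).2 ⟨-n, by simp, by simp⟩
    · rintro ⟨z, hz⟩
      change Q.mkQ (0, z) = _ at hz
      rw [eq_comm, ← sub_eq_zero, ← map_sub] at hz
      obtain ⟨n, hn, -⟩ := (hQ _ _).1 hz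
      exact ⟨n, by rw [hn]; exact sub_zero x⟩

/-- The kernels in the horseshoe construction. -/
theorem IsSES.exists_horseshoe (h : IsSES f g) {T U : Type} [AddCommGroup T] [Module R T]
    [AddCommGroup U] [Module R U] {a : T →ₗ[R] A} {b : U →ₗ[R] B}
    (ha : Function.Surjective a) (hb : Function.Surjective b) :
    ∃ (c : T × U →ₗ[R] B) (u : LinearMap.ker a →ₗ[R] LinearMap.ker c)
      (v : LinearMap.ker c →ₗ[R] LinearMap.ker (g.comp b)),
      Function.Surjective c ∧ IsSES u v := by
  let c : T × U →ₗ[R] B := (f.comp a).coprod b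
  have hc : ∀ x y, c (x, y) = f (a x) + b y := fun _ _ => rfl
  refine ⟨c, ((LinearMap.inl R T U).comp (LinearMap.ker a).subtype).codRestrict _ fun x => ?_,
    ((LinearMap.snd R T U).comp (LinearMap.ker c).subtype).codRestrict _ fun x => ?_,
    fun y => ?_, fun x y hxy => ?_, fun y => ?_, fun x => ?_⟩
  · change c (x, 0) = 0
    rw [hc, x.2, map_zero, map_zero, add_zero]
  · obtain ⟨⟨x, y⟩, hxy⟩ := x
    have hxy : f (a x) + b y = 0 := hxy
    change g (b y) = 0
    rw [eq_neg_of_add_eq_zero_right hxy, map_neg, h.exact.apply_apply_eq_zero, neg_zero]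
  · obtain ⟨u, rfl⟩ := hb y
    exact ⟨(0, u), by rw [hc, map_zero, map_zero, zero_add]⟩
  · exact Subtype.ext (congrArg (fun z : LinearMap.ker c => z.1.1) hxy)
  · obtain ⟨y, hy⟩ := y
    obtain ⟨z, hz⟩ := (h.exact (b y)).1 hy
    obtain ⟨x, rfl⟩ := ha z
    exact ⟨⟨(-x, y), by change c (-x, y) = 0; rw [hc, map_neg, map_neg, hz, neg_add_cancel]⟩, rfl⟩
  · obtain ⟨⟨x, y⟩, hxy⟩ := x
    constructor
    · intro h0
      have h0 : y = 0 := congrArg Subtype.val h0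
      subst h0
      have hxy : f (a x) + b 0 = 0 := hxy
      rw [map_zero, add_zero, map_eq_zero_iff f h.inj] at hxy
      exact ⟨⟨x, hxy⟩, rfl⟩
    · rintro ⟨z, hz⟩
      exact Subtype.ext (congrArg (fun z : LinearMap.ker c => z.1.2) hz).symm

end Filtration

section Shift

variable {R : Type} [Ring R] {S : Submonoid R} {Ω : Type} [CommMonoid Ω]

/-- `Ω`-valued functions on `R`-modules. -/
abbrev ModFun (R : Type) [Ring R] (Ω : Type) : Type 1 :=
  (M : Type) → [AddCommGroup M] → [Module R M] → Ω

/-- The analogue of a quasi-Fitting invariant on the modules in `MemD R S k`. -/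
structure IsQF (R : Type) [Ring R] (S : Submonoid R) {Ω : Type} [CommMonoid Ω] (k : ℕ)
    (φ : ModFun R Ω) : Prop where
  isUnit : ∀ (P : Type) [AddCommGroup P] [Module R P], MemD R S k P → FinitePd R P → IsUnit (φ P)
  quot : ∀ {A B P : Type} [AddCommGroup A] [Module R A] [AddCommGroup B] [Module R B]
    [AddCommGroup P] [Module R P] {f : A →ₗ[R] B} {g : B →ₗ[R] P}, IsSES f g → MemD R S k A →
    MemD R S k P → FinitePd R P → φ B = φ P * φ A
  sub : ∀ {P B C : Type} [AddCommGroup P] [Module R P] [AddCommGroup B] [Module R B]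
    [AddCommGroup C] [Module R C] {f : P →ₗ[R] B} {g : B →ₗ[R] C}, IsSES f g → MemD R S k P →
    FinitePd R P → MemD R S k C → φ B = φ P * φ C

theorem IsQF.mono {k l : ℕ} {φ : ModFun R Ω} (h : IsQF R S k φ) (hlk : l ≤ k) :
    IsQF R S l φ where
  isUnit P _ _ hP := h.isUnit P (hP.mono hlk)
  quot s hA hP := h.quot s (hA.mono hlk) (hP.mono hlk)
  sub s hP hf hC := h.sub s (hP.mono hlk) hf (hC.mono hlk)

theorem IsQF.eq_one {k : ℕ} {φ : ModFun R Ω} (h : IsQF R S k φ) (Z : Type) [AddCommGroup Z]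
    [Module R Z] [Subsingleton Z] : φ Z = 1 := by
  have hs : IsSES (LinearMap.id : Z →ₗ[R] Z) (0 : Z →ₗ[R] Z) :=
    ⟨Function.injective_id, fun _ => ⟨0, Subsingleton.elim _ _⟩, fun x =>
      ⟨fun _ => ⟨x, rfl⟩, fun _ => rfl⟩⟩
  have hD := memD_of_subsingleton (S := S) k Z
  have := h.quot hs hD hD (finitePd_of_subsingleton Z)
  exact (h.isUnit Z hD (finitePd_of_subsingleton Z)).mul_left_cancel (by rw [← this, mul_one])

theorem IsQuasiFittingInv.isQF [IsNoetherianRing R] {F : ModFun R Ω}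
    (hF : IsQuasiFittingInv R S F) : IsQF R S 0 F := by
  have hP : ∀ (P : Type) [AddCommGroup P] [Module R P], MemD R S 0 P → FinitePd R P →
      MemP R S P := fun P _ _ h h' => by
    have := h.1.1
    exact ⟨h.1, pdLE_one_of_finitePd h' (memD_zero_iff.1 h).2⟩
  exact ⟨fun P _ _ h h' => hF.1 P (hP P h h'),
    fun s hA h h' => hF.2.1 _ _ _ (memD_zero_iff.1 hA) (memD_zero_iff.1 (s.memD_mid hA h))
      (hP _ h h') _ _ s.inj s.surj s.exact,
    fun s h h' hC => hF.2.2 _ _ _ (hP _ h h') (memD_zero_iff.1 (s.memD_mid h hC))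
      (memD_zero_iff.1 hC) _ _ s.inj s.surj s.exact⟩

/-- `ω` is a value of the positive shift of `φ` at `M`. -/
def IsPlusValue (S : Submonoid R) (φ : ModFun R Ω) (M : Type) [AddCommGroup M] [Module R M]
    (ω : Ω) : Prop :=
  ∃ (N P : Type) (_ : AddCommGroup N) (_ : Module R N) (_ : AddCommGroup P) (_ : Module R P)
    (i : N →ₗ[R] P) (p : P →ₗ[R] M), IsSES i p ∧ MemP R S P ∧ φ P * ω = φ N

/-- `ω` is a value of the negative shift of `φ` at `N`. -/
def IsMinusValue (S : Submonoid R) (φ : ModFun R Ω) (N : Type) [AddCommGroup N] [Module R N]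
    (ω : Ω) : Prop :=
  ∃ (P C : Type) (_ : AddCommGroup P) (_ : Module R P) (_ : AddCommGroup C) (_ : Module R C)
    (i : N →ₗ[R] P) (p : P →ₗ[R] C), IsSES i p ∧ MemP R S P ∧ MemC R S C ∧ φ P * ω = φ C

open scoped Classical in
/-- The positive shift of `φ`. -/
noncomputable def plusShift (S : Submonoid R) (φ : ModFun R Ω) : ModFun R Ω := fun M _ _ =>
  if h : ∃ ω, IsPlusValue S φ M ω then h.choose else 1

open scoped Classical in
/-- The negative shift of `φ`. -/
noncomputable def minusShift (S : Submonoid R) (φ : ModFun R Ω) : ModFun R Ω := fun M _ _ =>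
  if h : ∃ ω, IsMinusValue S φ M ω then h.choose else 1

theorem exists_mul_eq_of_isUnit {a : Ω} (h : IsUnit a) (b : Ω) : ∃ ω, a * ω = b := by
  obtain ⟨c, hc⟩ := h.exists_right_inv
  exact ⟨c * b, by rw [← mul_assoc, hc, one_mul]⟩

/-- The `j`-th positive shift of the `m`-th negative shift of `φ`. -/
noncomputable def biShift (S : Submonoid R) (φ : ModFun R Ω) (j m : ℕ) : ModFun R Ω :=
  (plusShift S)^[j] ((minusShift S)^[m] φ)

theorem biShift_succ_left (S : Submonoid R) (φ : ModFun R Ω) (j m : ℕ) :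
    biShift S φ (j + 1) m = plusShift S (biShift S φ j m) :=
  Function.iterate_succ_apply' _ _ _

theorem IsQF.minus_value_unique {φ : ModFun R Ω} (h : IsQF R S 0 φ)
    {N P₁ C₁ P₂ C₂ : Type} [AddCommGroup N] [Module R N]
    [AddCommGroup P₁] [Module R P₁] [AddCommGroup C₁] [Module R C₁]
    [AddCommGroup P₂] [Module R P₂] [AddCommGroup C₂] [Module R C₂]
    {i₁ : N →ₗ[R] P₁} {p₁ : P₁ →ₗ[R] C₁} {i₂ : N →ₗ[R] P₂} {p₂ : P₂ →ₗ[R] C₂}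
    (h₁ : IsSES i₁ p₁) (h₂ : IsSES i₂ p₂) (hC₁ : MemD R S 0 C₁) (hC₂ : MemD R S 0 C₂)
    (hP₁ : MemD R S 0 P₁) (hf₁ : FinitePd R P₁) (hP₂ : MemD R S 0 P₂) (hf₂ : FinitePd R P₂)
    {ω₁ ω₂ : Ω} (e₁ : φ P₁ * ω₁ = φ C₁) (e₂ : φ P₂ * ω₂ = φ C₂) : ω₁ = ω₂ := by
  obtain ⟨Y, _, _, a₁, b₂, a₂, b₁, s₁, s₂⟩ := h₁.exists_pushout h₂
  have t₁ := h.sub s₁ hP₁ hf₁ hC₂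
  have t₂ := h.sub s₂ hP₂ hf₂ hC₁
  refine ((h.isUnit P₂ hP₂ hf₂).mul (h.isUnit P₁ hP₁ hf₁)).mul_left_cancel ?_
  rw [mul_assoc, e₁, ← t₂, t₁, ← e₂]
  ac_rfl

variable [IsNoetherianRing R]

theorem IsQF.plus_value_unique {k : ℕ} {φ : ModFun R Ω} (h : IsQF R S k φ)
    {M N₁ P₁ N₂ P₂ : Type} [AddCommGroup M] [Module R M]
    [AddCommGroup N₁] [Module R N₁] [AddCommGroup P₁] [Module R P₁]
    [AddCommGroup N₂] [Module R N₂] [AddCommGroup P₂] [Module R P₂]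
    {i₁ : N₁ →ₗ[R] P₁} {p₁ : P₁ →ₗ[R] M} {i₂ : N₂ →ₗ[R] P₂} {p₂ : P₂ →ₗ[R] M}
    (h₁ : IsSES i₁ p₁) (h₂ : IsSES i₂ p₂) (hM : MemD R S (k + 1) M)
    (hP₁ : MemD R S k P₁) (hf₁ : FinitePd R P₁) (hP₂ : MemD R S k P₂) (hf₂ : FinitePd R P₂)
    {ω₁ ω₂ : Ω} (e₁ : φ P₁ * ω₁ = φ N₁) (e₂ : φ P₂ * ω₂ = φ N₂) : ω₁ = ω₂ := by
  obtain ⟨X, _, _, a₁, b₂, a₂, b₁, s₁, s₂⟩ := h₁.exists_pullback h₂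
  have t₁ := h.quot s₁ (h₁.memD_left hP₁ hM) hP₂ hf₂
  have t₂ := h.quot s₂ (h₂.memD_left hP₂ hM) hP₁ hf₁
  refine ((h.isUnit P₂ hP₂ hf₂).mul (h.isUnit P₁ hP₁ hf₁)).mul_left_cancel ?_
  rw [mul_assoc, e₁, ← t₁, t₂, ← e₂]
  ac_rfl

theorem IsQF.mul_plusShift (hS : IsOreSet R S) {k : ℕ} {φ : ModFun R Ω} (h : IsQF R S k φ)
    {N P M : Type} [AddCommGroup N] [Module R N] [AddCommGroup P] [Module R P]
    [AddCommGroup M] [Module R M] {i : N →ₗ[R] P} {p : P →ₗ[R] M} (s : IsSES i p)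
    (hP : MemD R S k P) (hf : FinitePd R P) (hM : MemD R S (k + 1) M) :
    φ P * plusShift S φ M = φ N := by
  have hex : ∃ ω, IsPlusValue S φ M ω := by
    obtain ⟨P', _, _, p', hP', hp'⟩ := hM.1.exists_cover hS
    obtain ⟨ω, hω⟩ := exists_mul_eq_of_isUnit (h.isUnit P' (hP'.memD k) hP'.finitePd)
      (φ (LinearMap.ker p'))
    exact ⟨ω, _, _, _, _, _, _, _, _, isSES_ker hp', hP', hω⟩
  have hv : plusShift S φ M = hex.choose := dif_pos hex
  obtain ⟨N', P', _, _, _, _, i', p', s', hP', e⟩ := hex.choose_spec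
  rw [← hv] at e
  obtain ⟨ω, hω⟩ := exists_mul_eq_of_isUnit (h.isUnit P hP hf) (φ N)
  rw [← hω, h.plus_value_unique s' s hM (hP'.memD k) hP'.finitePd hP hf e hω]

theorem IsQF.mul_plusShift_self (hS : IsOreSet R S) {k : ℕ} {φ : ModFun R Ω} (h : IsQF R S k φ)
    {P : Type} [AddCommGroup P] [Module R P] (hP : MemD R S k P) (hf : FinitePd R P) :
    φ P * plusShift S φ P = 1 := by
  rw [h.mul_plusShift hS (isSES_id_left P) hP hf (hP.mono k.le_succ), h.eq_one]

theorem IsQF.isQF_plusShift (hS : IsOreSet R S) {k : ℕ} {φ : ModFun R Ω} (h : IsQF R S k φ) :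
    IsQF R S (k + 1) (plusShift S φ) where
  isUnit Q _ _ hQ hf := by
    obtain ⟨P, _, _, p, hP, hp⟩ := hQ.1.exists_cover hS
    have s := isSES_ker hp
    have hN := s.memD_left (hP.memD k) hQ
    have := hP.1.1
    have := hQ.1.1
    have := hN.1.1
    have e := h.mul_plusShift hS s (hP.memD k) hP.finitePd hQ
    have hu := h.isUnit _ hN (s.finitePd_left hP.finitePd hf)
    rw [← e] at hu
    exact isUnit_of_mul_isUnit_right hu
  quot {A B P} _ _ _ _ _ _ f g s hA hP hf := by
    have hB := s.memD_mid hA hP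
    obtain ⟨T, _, _, r, hT, hr⟩ := hB.1.exists_cover hS
    obtain ⟨K, _, _, j, u, v, s₁, s₂⟩ := s.exists_kernel (isSES_ker hr)
    have hK := s₁.memD_left (hT.memD k) hP
    have := hT.1.1
    have := hP.1.1
    have := hK.1.1
    have hKf := s₁.finitePd_left hT.finitePd hf
    have e₁ := h.mul_plusShift hS (isSES_ker hr) (hT.memD k) hT.finitePd hB
    have e₂ := h.mul_plusShift hS s₁ (hT.memD k) hT.finitePd hP
    have e₃ := h.mul_plusShift hS s₂ hK hKf hA
    refine (h.isUnit T (hT.memD k) hT.finitePd).mul_left_cancel ?_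
    rw [e₁, ← mul_assoc, e₂, e₃]
  sub {P B C} _ _ _ _ _ _ f g s hP hf hC := by
    have hB := s.memD_mid hP hC
    obtain ⟨T, _, _, a, hT, ha⟩ := hP.1.exists_cover hS
    obtain ⟨U, _, _, b, hU, hb⟩ := hB.1.exists_cover hS
    obtain ⟨c, u, v, hc, s'⟩ := s.exists_horseshoe ha hb
    have hgb : Function.Surjective (g.comp b) := s.surj.comp hb
    have hTD := hT.memD k
    have hUD := hU.memD k
    have hTU := isSES_inl_snd (R := R) T U
    have := hT.1.1
    have := hU.1.1
    have := hP.1.1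
    have hN := (isSES_ker ha).memD_left hTD hP
    have := hN.1.1
    have e₁ := h.mul_plusShift hS (isSES_ker ha) hTD hT.finitePd hP
    have e₂ := h.mul_plusShift hS (isSES_ker hgb) hUD hU.finitePd hC
    have e₃ := h.mul_plusShift hS (isSES_ker hc) (hTU.memD_mid hTD hUD)
      (hTU.finitePd_mid hT.finitePd hU.finitePd) hB
    rw [h.sub s' hN ((isSES_ker ha).finitePd_left hT.finitePd hf)
      ((isSES_ker hgb).memD_left hUD hC), h.sub hTU hTD hT.finitePd hUD, ← e₁, ← e₂] at e₃
    refine ((h.isUnit T hTD hT.finitePd).mul (h.isUnit U hUD hU.finitePd)).mul_left_cancel ?_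
    rw [e₃]
    ac_rfl

theorem IsQF.plusShift_congr (hS : IsOreSet R S) {k : ℕ} {φ χ : ModFun R Ω} (h : IsQF R S k φ)
    (h' : IsQF R S k χ)
    (he : ∀ (M : Type) [AddCommGroup M] [Module R M], MemD R S k M → φ M = χ M)
    (M : Type) [AddCommGroup M] [Module R M] (hM : MemD R S (k + 1) M) :
    plusShift S φ M = plusShift S χ M := by
  obtain ⟨P, _, _, p, hP, hp⟩ := hM.1.exists_cover hS
  have s := isSES_ker hp
  have hPD := hP.memD k
  refine (h.isUnit P hPD hP.finitePd).mul_left_cancel ?_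
  rw [h.mul_plusShift hS s hPD hP.finitePd hM, he _ hPD,
    h'.mul_plusShift hS s hPD hP.finitePd hM, he _ (s.memD_left hPD hM)]

theorem IsQF.iterate_plusShift (hS : IsOreSet R S) {φ : ModFun R Ω}
    (h : IsQF R S 0 φ) (j : ℕ) : IsQF R S j ((plusShift S)^[j] φ) := by
  induction j with
  | zero => exact h
  | succ j ih =>
    rw [Function.iterate_succ_apply']
    exact ih.isQF_plusShift hS

variable [IsNoetherianRing Rᵐᵒᵖ]

theorem IsQF.mul_minusShift (hS : IsOreSet R S) (hstar : AssumptionStar R) {φ : ModFun R Ω}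
    (h : IsQF R S 0 φ) {N P C : Type} [AddCommGroup N] [Module R N] [AddCommGroup P] [Module R P]
    [AddCommGroup C] [Module R C] {i : N →ₗ[R] P} {p : P →ₗ[R] C} (s : IsSES i p)
    (hP : MemD R S 0 P) (hf : FinitePd R P) (hC : MemD R S 0 C) :
    φ P * minusShift S φ N = φ C := by
  have hN := s.memD_left hP (hC.mono zero_le_one)
  have hex : ∃ ω, IsMinusValue S φ N ω := by
    obtain ⟨P', C', _, _, _, _, i', p', hP', hC', s'⟩ :=
      (memD_zero_iff.1 hN).exists_embedding hS hstar
    obtain ⟨ω, hω⟩ := exists_mul_eq_of_isUnit (h.isUnit P' (hP'.memD 0) hP'.finitePd) (φ C')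
    exact ⟨ω, _, _, _, _, _, _, _, _, s', hP', hC', hω⟩
  have hv : minusShift S φ N = hex.choose := dif_pos hex
  obtain ⟨P', C', _, _, _, _, i', p', s', hP', hC', e⟩ := hex.choose_spec
  rw [← hv] at e
  obtain ⟨ω, hω⟩ := exists_mul_eq_of_isUnit (h.isUnit P hP hf) (φ C)
  rw [← hω, h.minus_value_unique s' s (memD_zero_iff.2 hC') hC (hP'.memD 0) hP'.finitePd hP hf
    e hω]

theorem IsQF.mul_minusShift_self (hS : IsOreSet R S) (hstar : AssumptionStar R) {φ : ModFun R Ω}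
    (h : IsQF R S 0 φ) {P : Type} [AddCommGroup P] [Module R P] (hP : MemD R S 0 P)
    (hf : FinitePd R P) : φ P * minusShift S φ P = 1 := by
  rw [h.mul_minusShift hS hstar (isSES_id_right P) hP hf (memD_of_subsingleton _ _), h.eq_one]

theorem IsQF.isQF_minusShift (hS : IsOreSet R S) (hstar : AssumptionStar R) {φ : ModFun R Ω}
    (h : IsQF R S 0 φ) : IsQF R S 0 (minusShift S φ) where
  isUnit P _ _ hP hf := .of_mul_eq_one_right _ (h.mul_minusShift_self hS hstar hP hf)
  quot {A B P} _ _ _ _ _ _ f g s hA hP hf := by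
    have hB := s.memD_mid hA hP
    obtain ⟨T, K, _, _, _, _, e, q, hT, hK, s'⟩ :=
      (memD_zero_iff.1 hB).exists_embedding hS hstar
    rw [← memD_zero_iff] at hK
    obtain ⟨Q, _, _, p, u, v, s₁, s₂⟩ := s.exists_quotient s'
    have e₁ := h.mul_minusShift hS hstar s' (hT.memD 0) hT.finitePd hK
    have e₂ := h.mul_minusShift hS hstar s₁ (hT.memD 0) hT.finitePd (s₂.memD_mid hP hK)
    have e₃ := h.mul_minusShift_self hS hstar hP hf
    rw [h.sub s₂ hP hf hK, ← e₁] at e₂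
    refine (h.isUnit T (hT.memD 0) hT.finitePd).mul_left_cancel ?_
    rw [mul_left_comm, e₂, ← mul_assoc, mul_comm _ (φ P), e₃, one_mul]
  sub {P B C} _ _ _ _ _ _ f g s hP hf hC := by
    have hB := s.memD_mid hP hC
    obtain ⟨T, K, _, _, _, _, e, q, hT, hK, s'⟩ :=
      (memD_zero_iff.1 hB).exists_embedding hS hstar
    rw [← memD_zero_iff] at hK
    obtain ⟨Q, _, _, p, u, v, s₁, s₂⟩ := s.exists_quotient s'
    have hQ := s₂.memD_mid hC hK
    have := hT.1.1
    have := hP.1.1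
    have := hQ.1.1
    have e₁ := h.mul_minusShift hS hstar s' (hT.memD 0) hT.finitePd hK
    have e₂ := h.mul_minusShift hS hstar s₁ (hT.memD 0) hT.finitePd hQ
    have e₃ := h.mul_minusShift hS hstar s₂ hQ (s₁.finitePd_right hf hT.finitePd) hK
    refine (h.isUnit T (hT.memD 0) hT.finitePd).mul_left_cancel ?_
    rw [e₁, ← mul_assoc, e₂, e₃]

theorem IsQF.plusShift_minusShift (hS : IsOreSet R S) (hstar : AssumptionStar R)
    {φ : ModFun R Ω} (h : IsQF R S 0 φ) (M : Type) [AddCommGroup M] [Module R M]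
    (hM : MemD R S 0 M) : plusShift S (minusShift S φ) M = φ M := by
  obtain ⟨P, _, _, p, hP, hp⟩ := hM.1.exists_cover hS
  have s := isSES_ker hp
  have e₁ := (h.isQF_minusShift hS hstar).mul_plusShift hS s (hP.memD 0) hP.finitePd
    (hM.mono zero_le_one)
  rw [← h.mul_minusShift hS hstar s (hP.memD 0) hP.finitePd hM, ← e₁, ← mul_assoc,
    h.mul_minusShift_self hS hstar (hP.memD 0) hP.finitePd, one_mul]

theorem IsQF.iterate_minusShift (hS : IsOreSet R S) (hstar : AssumptionStar R) {φ : ModFun R Ω}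
    (h : IsQF R S 0 φ) (m : ℕ) : IsQF R S 0 ((minusShift S)^[m] φ) := by
  induction m with
  | zero => exact h
  | succ m ih =>
    rw [Function.iterate_succ_apply']
    exact ih.isQF_minusShift hS hstar

theorem IsQF.isQF_biShift (hS : IsOreSet R S) (hstar : AssumptionStar R) {φ : ModFun R Ω}
    (h : IsQF R S 0 φ) (j m : ℕ) : IsQF R S j (biShift S φ j m) :=
  (h.iterate_minusShift hS hstar m).iterate_plusShift hS j

theorem IsQF.biShift_succ_succ (hS : IsOreSet R S) (hstar : AssumptionStar R) {φ : ModFun R Ω}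
    (h : IsQF R S 0 φ) (j m : ℕ) (M : Type) [AddCommGroup M] [Module R M]
    (hM : MemD R S j M) : biShift S φ (j + 1) (m + 1) M = biShift S φ j m M := by
  induction j generalizing M with
  | zero =>
    change plusShift S ((minusShift S)^[m + 1] φ) M = _
    rw [Function.iterate_succ_apply']
    exact (h.iterate_minusShift hS hstar m).plusShift_minusShift hS hstar M hM
  | succ j ih =>
    rw [biShift_succ_left, biShift_succ_left S φ j m]
    exact IsQF.plusShift_congr hS ((h.isQF_biShift hS hstar (j + 1) (m + 1)).mono j.le_succ)
      (h.isQF_biShift hS hstar j m) (fun M _ _ hM => ih M hM) M hM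

theorem IsQF.biShift_self (hS : IsOreSet R S) (hstar : AssumptionStar R) {φ : ModFun R Ω}
    (h : IsQF R S 0 φ) (j : ℕ) (M : Type) [AddCommGroup M] [Module R M]
    (hM : MemD R S 0 M) : biShift S φ j j M = φ M := by
  induction j with
  | zero => rfl
  | succ j ih => rw [h.biShift_succ_succ hS hstar j j M (hM.mono (Nat.zero_le j)), ih]

theorem IsQuasiFittingInv.exists_isShiftFamily (hS : IsOreSet R S) (hstar : AssumptionStar R)
    {F : ModFun R Ω} (hF : IsQuasiFittingInv R S F) :
    ∃ G : ℤ → ModFun R Ω, IsShiftFamily R S F G := by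
  obtain ⟨d, hd⟩ := hstar.exists_memD S
  have h := hF.isQF
  let G : ℤ → ModFun R Ω := fun n => biShift S F (d + n.toNat) (d + (-n).toNat)
  have hG : ∀ n, IsQF R S d (G n) := fun n =>
    (h.isQF_biShift hS hstar _ _).mono (Nat.le_add_right _ _)
  have hstep : ∀ n (M : Type) [AddCommGroup M] [Module R M], MemM R S M →
      G n M = plusShift S (G (n - 1)) M := fun n M _ _ hM => by
    change biShift S F _ _ M = plusShift S (biShift S F _ _) M
    rw [← biShift_succ_left]
    rcases lt_or_ge 0 n with hn | hn
    · rw [show d + n.toNat = d + (n - 1).toNat + 1 by omega,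
        show (-n).toNat = (-(n - 1)).toNat by omega]
    · rw [show (-(n - 1)).toNat = (-n).toNat + 1 by omega, ← Nat.add_assoc,
        show (n - 1).toNat = n.toNat by omega,
        h.biShift_succ_succ hS hstar _ _ M ((hd M hM).mono (Nat.le_add_right _ _))]
  refine ⟨G, fun M _ _ hM => ?_, fun n P _ _ hP => (hG n).isUnit P (hd P hP.1) hP.2,
    fun n N P M _ _ _ _ _ _ hN hP hM i p hi hp he => ?_,
    fun n M' M P _ _ _ _ _ _ hM' hM hP i p hi hp he =>
      (hG n).quot ⟨hi, hp, he⟩ (hd M' hM') (hd P hP.1) hP.2,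
    fun n P M M' _ _ _ _ _ _ hP hM hM' i p hi hp he =>
      (hG n).sub ⟨hi, hp, he⟩ (hd P hP.1) hP.2 (hd M' hM')⟩
  · exact h.biShift_self hS hstar d M (memD_zero_iff.2 hM)
  · rw [← (hG (n - 1)).mul_plusShift hS ⟨hi, hp, he⟩ (hd P hP.1) hP.2
      ((hd M hM).mono d.le_succ), ← hstep n M hM, ← mul_assoc, mul_comm (G n P), hstep n P hP.1,
      (hG (n - 1)).mul_plusShift_self hS (hd P hP.1) hP.2, one_mul]

end Shift

section Uniqueness

variable {R : Type} [Ring R] {S : Submonoid R} {Ω : Type} [CommMonoid Ω]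
  {F : ModFun R Ω} {G G' : ℤ → ModFun R Ω}

theorem IsShiftFamily.isQF (h : IsShiftFamily R S F G) (n : ℤ) : ∀ k, IsQF R S k (G n) := fun _ =>
  ⟨fun P _ _ hP hf => h.2.1 n P ⟨hP.1, hf⟩,
    fun s hA hP hf => h.2.2.2.1 n _ _ _ hA.1 (s.memM_mid hA.1 hP.1) ⟨hP.1, hf⟩ _ _ s.inj s.surj
      s.exact,
    fun s hP hf hC => h.2.2.2.2 n _ _ _ ⟨hP.1, hf⟩ (s.memM_mid hP.1 hC.1) hC.1 _ _ s.inj s.surj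
      s.exact⟩

variable [IsNoetherianRing R]

theorem IsShiftFamily.eq_mul (h : IsShiftFamily R S F G) (n : ℤ) {N P M : Type} [AddCommGroup N]
    [Module R N] [AddCommGroup P] [Module R P] [AddCommGroup M] [Module R M] {i : N →ₗ[R] P}
    {p : P →ₗ[R] M} (s : IsSES i p) (hP : MemP R S P) :
    G (n + 1) M = G (n + 1) P * G n N := by
  have := h.2.2.1 (n + 1) N P M (hP.1.of_injective s.inj) ⟨hP.1, hP.finitePd⟩
    (hP.1.of_surjective s.surj) i p s.inj s.surj s.exact
  rwa [add_sub_cancel_right] at this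

theorem IsShiftFamily.mul_eq_one (h : IsShiftFamily R S F G) (n : ℤ) {P : Type} [AddCommGroup P]
    [Module R P] (hP : MemP R S P) : G (n + 1) P * G n P = 1 := by
  rw [← h.eq_mul n (isSES_id_right P) hP, (h.isQF (n + 1) 0).eq_one]

theorem IsShiftFamily.eq_of_memP (h : IsShiftFamily R S F G) (h' : IsShiftFamily R S F G') (n : ℤ)
    {P : Type} [AddCommGroup P] [Module R P] (hP : MemP R S P) : G n P = G' n P := by
  induction n using Int.induction_on with
  | zero => rw [h.1 P hP.memC, h'.1 P hP.memC]
  | succ n ih =>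
    refine ((h.isQF n 0).isUnit P (hP.memD 0) hP.finitePd).mul_right_cancel ?_
    rw [h.mul_eq_one n hP, ih, h'.mul_eq_one n hP]
  | pred n ih =>
    have e := h.mul_eq_one (-n - 1) hP
    have e' := h'.mul_eq_one (-n - 1) hP
    rw [sub_add_cancel] at e e'
    refine ((h.isQF (-n) 0).isUnit P (hP.memD 0) hP.finitePd).mul_left_cancel ?_
    rw [e, ih, e']

variable [IsNoetherianRing Rᵐᵒᵖ]

theorem IsShiftFamily.eq_of_memC (hS : IsOreSet R S) (hstar : AssumptionStar R)
    (h : IsShiftFamily R S F G) (h' : IsShiftFamily R S F G') (n : ℤ)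
    {M : Type} [AddCommGroup M] [Module R M] (hM : MemC R S M) : G n M = G' n M := by
  induction n using Int.induction_on generalizing M with
  | zero => rw [h.1 M hM, h'.1 M hM]
  | succ n ih =>
    obtain ⟨P, _, _, p, hP, hp⟩ := hM.1.exists_cover hS
    have s := isSES_ker hp
    rw [h.eq_mul n s hP, h'.eq_mul n s hP, h.eq_of_memP h' _ hP, ih (memD_zero_iff.1
      (s.memD_left (hP.memD 0) ((memD_zero_iff.2 hM).mono zero_le_one)))]
  | pred n ih =>
    obtain ⟨P, C, _, _, _, _, i, p, hP, hC, s⟩ := hM.exists_embedding hS hstar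
    have e := h.eq_mul (-n - 1) s hP
    have e' := h'.eq_mul (-n - 1) s hP
    rw [sub_add_cancel] at e e'
    refine ((h.isQF (-n) 0).isUnit P (hP.memD 0) hP.finitePd).mul_left_cancel ?_
    rw [← e, ih hC, e', h.eq_of_memP h' _ hP]

theorem IsShiftFamily.eq_of_memD (hS : IsOreSet R S) (hstar : AssumptionStar R)
    (h : IsShiftFamily R S F G) (h' : IsShiftFamily R S F G') (k : ℕ) (n : ℤ)
    {M : Type} [AddCommGroup M] [Module R M] (hM : MemD R S k M) : G n M = G' n M := by
  induction k generalizing n M with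
  | zero => exact h.eq_of_memC hS hstar h' n (memD_zero_iff.1 hM)
  | succ k ih =>
    obtain ⟨P, _, _, p, hP, hp⟩ := hM.1.exists_cover hS
    have s := isSES_ker hp
    have e := h.eq_mul (n - 1) s hP
    have e' := h'.eq_mul (n - 1) s hP
    rw [sub_add_cancel] at e e'
    rw [e, e', h.eq_of_memP h' _ hP, ih _ (s.memD_left (hP.memD k) hM)]

end Uniqueness

/-- Let `R` be left and right noetherian with an Ore set `S` of
non-zero-divisors, satisfying Assumption (⋆), and let `𝓕 : 𝓒 → Ω` be a quasi-Fitting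
invariant.  Then there is a family `{𝓕⟨n⟩ : 𝓜 → Ω}` (n ∈ ℤ) satisfying (a) `𝓕⟨0⟩`
extends `𝓕`, (b) `𝓕⟨n⟩(P)` is invertible for `P ∈ 𝓠`, and the multiplicativity
properties (c)–(e) for short exact sequences in `𝓜` with a term in `𝓠`; and this family
is unique (any two such families agree on `𝓜`). -/
theorem statement12
    (R : Type) [Ring R] [IsNoetherianRing R] [IsNoetherianRing Rᵐᵒᵖ]
    (S : Submonoid R) (hS : IsOreSet R S) (hstar : AssumptionStar R)
    (Ω : Type) [CommMonoid Ω]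
    (F : (M : Type) → [AddCommGroup M] → [Module R M] → Ω)
    (hF : IsQuasiFittingInv R S F) :
    (∃ G : ℤ → (M : Type) → [AddCommGroup M] → [Module R M] → Ω, IsShiftFamily R S F G) ∧
    (∀ G G' : ℤ → (M : Type) → [AddCommGroup M] → [Module R M] → Ω,
      IsShiftFamily R S F G → IsShiftFamily R S F G' →
      ∀ (n : ℤ) (M : Type) [AddCommGroup M] [Module R M], MemM R S M → G n M = G' n M) := by
  refine ⟨hF.exists_isShiftFamily hS hstar, fun G G' h h' n M _ _ hM => ?_⟩
  obtain ⟨d, hd⟩ := hstar.exists_memD S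
  exact h.eq_of_memD hS hstar h' d n (hd M hM)
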